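/- Let n ≥ 3, let G = D_{2n} = ⟨a, b | a^n = b^2 = 1, bab = a^{-1}⟩, and let C be an inverse-closed generating set of G with |C| = 4 (all exponents read modulo n). Then C is transitive (equivalently, the Cayley graph Cay(G;C) is a 4-valent normal edge-transitive Cayley graph) if and only if there exists σ ∈ Aut(G) such that C^σ is one of the following sets: (a) {b, ba, ba^i, ba^{1-i}} for some i with 2 ≤ i ≤ n-1, gcd(2i-1, n) = 1 and n dividing 2i(i-1); (b) {b, ba, ba^{k+1}, ba^{k^2+k+1}} for some k with 1 ≤ k ≤ n-2, gcd(k, n) = 1 and n dividing 1+k+k^2+k^3; or (c) {b, ba^i, ba^j, ba^k} where n ≥ 5, 1 < i, j, k < n, i, j, k are pairwise coprime, gcd(i,n) > 1, gcd(j,n) > 1, gcd(k,n) > 1, and there exist integers ℓ, m with ℓ^2 ≡ m^2 ≡ 1 (mod n), ℓ, m, ℓm all ≢ 1 (mod n), k ≡ jℓ + i ≡ im + j (mod n), and i(ℓ+1) ≡ j(m+1) ≡ 0 (mod n). -/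

import Mathlib

namespace NETCayley

variable {G : Type*} [Group G]

/-- `Aut(G;C)`: the subgroup of `MulAut G` consisting of automorphisms `σ` with `C^σ = C`. -/
def autSub (C : Set G) : Subgroup (MulAut G) where
  carrier := {σ : MulAut G | ⇑σ '' C = C}
  one_mem' := by simp
  mul_mem' := by
    intro a b ha hb
    rw [Set.mem_setOf_eq] at ha hb ⊢
    have h : ⇑(a * b) = ⇑a ∘ ⇑b := rfl
    rw [h, Set.image_comp, hb, ha]
  inv_mem' := by
    intro a ha
    rw [Set.mem_setOf_eq] at ha ⊢
    conv_lhs => rw [← ha]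
    rw [← Set.image_comp]
    have h : ⇑a⁻¹ ∘ ⇑a = id := by funext x; simp
    rw [h, Set.image_id]

/-- `A(G;C)`: proper normal `Aut(G;C)`-invariant subgroups of `G`. -/
def setA (C : Set G) : Set (Subgroup G) :=
  {N | N.Normal ∧ N ≠ ⊤ ∧ ∀ σ ∈ autSub C, N.map (σ : MulAut G).toMonoidHom = N}

/-- `A_max(G;C)`: maximal (by inclusion) elements of `A(G;C)`. -/
def setAmax (C : Set G) : Set (Subgroup G) :=
  {N | N ∈ setA C ∧ ∀ M ∈ setA C, N ≤ M → N = M}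

/-- `Φ(G;C)`: the intersection of all members of `A_max(G;C)`. -/
def PhiC (C : Set G) : Subgroup G := sInf (setAmax C)

/-- `X` is normal `C`-closed: `(x^g)^σ ∈ X` for all `x ∈ X`, `g ∈ G`, `σ ∈ Aut(G;C)`. -/
def NormalCClosed (C X : Set G) : Prop :=
  ∀ x ∈ X, ∀ g : G, ∀ σ ∈ autSub C, σ (g⁻¹ * x * g) ∈ X

/-- The normal `C`-closure of `X`: `{(x^g)^σ : x ∈ X, g ∈ G, σ ∈ Aut(G;C)}`. -/
def normalCClosure (C X : Set G) : Set G :=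
  {y | ∃ x ∈ X, ∃ g : G, ∃ σ ∈ autSub C, σ (g⁻¹ * x * g) = y}

/-- The orbit of `c` under the natural action of `Aut(G;C)`. -/
def orbitC (C : Set G) (c : G) : Set G := {y | ∃ σ ∈ autSub C, σ c = y}

/-- `C` is a transitive set: either `Aut(G;C)` is transitive on `C`, or there are exactly two
orbits `C₊`, `C₋` on `C` with `C = C₊ ∪ C₋` and `C₋ = C₊⁻¹`. -/
def TransSet (C : Set G) : Prop :=
  (∀ c ∈ C, ∀ c' ∈ C, ∃ σ ∈ autSub C, σ c = c') ∨
  (∃ cp ∈ C, ∃ cm ∈ C, orbitC C cp ≠ orbitC C cm ∧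
    C = orbitC C cp ∪ orbitC C cm ∧ orbitC C cm = (orbitC C cp)⁻¹)

/-- A transitive inverse-closed generating set of `G`. -/
def IsTransGenSet (C : Set G) : Prop :=
  (1 : G) ∉ C ∧ (∀ c ∈ C, c⁻¹ ∈ C) ∧ Subgroup.closure C = ⊤ ∧ TransSet C

/-- The map underlying the automorphism `τ_k φ^m` of the dihedral group:
`a^i ↦ a^{ki}`, `b a^i ↦ b a^{ki+m}`. -/
def dihMap (n : ℕ) (k m : ZMod n) : DihedralGroup n → DihedralGroup n
  | .r i => .r (k * i)
  | .sr i => .sr (k * i + m)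

/-- The automorphism `τ_k φ^m` of the dihedral group (for `k` a unit mod `n`). -/
def dihAut (n : ℕ) (k : (ZMod n)ˣ) (m : ZMod n) : MulAut (DihedralGroup n) where
  toFun := dihMap n (k : ZMod n) m
  invFun := dihMap n ((k⁻¹ : (ZMod n)ˣ) : ZMod n) (-(((k⁻¹ : (ZMod n)ˣ) : ZMod n) * m))
  left_inv := by
    have hk : ((k⁻¹ : (ZMod n)ˣ) : ZMod n) * ((k : (ZMod n)ˣ) : ZMod n) = 1 := k.inv_mul
    rintro (i | i) <;> simp only [dihMap] <;> congr 1 <;> linear_combination (i : ZMod n) * hk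
  right_inv := by
    have hk : ((k : (ZMod n)ˣ) : ZMod n) * ((k⁻¹ : (ZMod n)ˣ) : ZMod n) = 1 := k.mul_inv
    rintro (i | i) <;> simp only [dihMap] <;> congr 1
    · linear_combination (i : ZMod n) * hk
    · linear_combination ((i : ZMod n) - m) * hk
  map_mul' := by
    rintro (i | i) (j | j) <;>
      simp only [DihedralGroup.r_mul_r, DihedralGroup.r_mul_sr, DihedralGroup.sr_mul_r,
        DihedralGroup.sr_mul_sr, dihMap] <;> congr 1 <;> ring


section NumberTheory

theorem recur_vanish {ι : Type*} (I : Finset ι) (c ω : ι → ℂ) (s0 : ℕ)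
    (h : ∀ s, s0 ≤ s → s < s0 + I.card → ∑ t ∈ I, c t * ω t ^ s = 0) :
    ∀ s, s0 ≤ s → ∑ t ∈ I, c t * ω t ^ s = 0 := by
  classical
  set q : Polynomial ℂ := ∏ t ∈ I, (Polynomial.X - Polynomial.C (ω t)) with hq
  have hmon : q.Monic := Polynomial.monic_prod_of_monic _ _ (fun t _ => Polynomial.monic_X_sub_C _)
  have hdeg : q.natDegree = I.card := by
    rw [hq, Polynomial.natDegree_prod_of_monic _ _ (fun t _ => Polynomial.monic_X_sub_C _)]
    simp
  have hroot : ∀ t ∈ I, q.eval (ω t) = 0 := by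
    intro t ht
    rw [hq, Polynomial.eval_prod]
    exact Finset.prod_eq_zero ht (by simp)
  have hrec : ∀ s, ∑ j ∈ Finset.range (I.card + 1), q.coeff j * (∑ t ∈ I, c t * ω t ^ (s + j)) = 0 := by
    intro s
    simp_rw [Finset.mul_sum]
    rw [Finset.sum_comm]
    apply Finset.sum_eq_zero
    intro t ht
    have := hroot t ht
    rw [Polynomial.eval_eq_sum_range, hdeg] at this
    calc _ = c t * ω t ^ s * ∑ i ∈ Finset.range (I.card + 1), q.coeff i * ω t ^ i := by
          rw [Finset.mul_sum]
          apply Finset.sum_congr rfl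
          intro j _
          rw [pow_add]; ring
      _ = 0 := by rw [this, mul_zero]
  intro s
  induction s using Nat.strong_induction_on with
  | _ s ih =>
    intro hs
    by_cases hlt : s < s0 + I.card
    · exact h s hs hlt
    · have h1 := hrec (s - I.card)
      rw [Finset.sum_range_succ, Finset.sum_eq_zero, zero_add] at h1
      · have h2 : q.coeff I.card = 1 := by
          have := hmon.coeff_natDegree
          rwa [hdeg] at this
        rw [h2, one_mul, Nat.sub_add_cancel (by omega)] at h1
        exact h1
      · intro j hj
        rw [Finset.mem_range] at hj
        rw [ih (s - I.card + j) (by omega) (by omega), mul_zero]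

theorem ap_coprime (a d : ℕ) (h : Nat.Coprime a d) (T : Finset ℕ) (hT : ∀ p ∈ T, p.Prime) (s0 : ℕ) :
    ∃ s, s0 ≤ s ∧ ∀ p ∈ T, ¬ p ∣ a + d * s := by
  classical
  set U := T.filter (fun p => ¬ p ∣ a) with hU
  have hpos : 0 < (∏ p ∈ U, p) := by
    apply Finset.prod_pos
    intro p hp
    exact (hT p (Finset.mem_filter.1 hp).1).pos
  obtain ⟨q, hq1, hq⟩ := Nat.exists_infinite_primes (s0 + ∑ p ∈ T, p + 1)
  refine ⟨(∏ p ∈ U, p) * q, ?_, ?_⟩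
  · have : 1 * q ≤ (∏ p ∈ U, p) * q := Nat.mul_le_mul_right _ hpos
    omega
  · intro p hp hdvd
    have hpp := hT p hp
    have hle : p ≤ ∑ p ∈ T, p := Finset.single_le_sum (f := fun p => p) (fun _ _ => Nat.zero_le _) hp
    by_cases hpa : p ∣ a
    · have h1 : p ∣ d * ((∏ p ∈ U, p) * q) := (Nat.dvd_add_right hpa).1 hdvd
      rcases hpp.dvd_mul.1 h1 with h2 | h2
      · exact Nat.not_coprime_of_dvd_of_dvd hpp.one_lt hpa h2 h
      · rcases hpp.dvd_mul.1 h2 with h3 | h3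
        · obtain ⟨r, hr, hpr⟩ := (hpp.prime.dvd_finsetProd_iff _).1 h3
          have hr' := Finset.mem_filter.1 hr
          have : p = r := (Nat.prime_dvd_prime_iff_eq hpp (hT r hr'.1)).1 hpr
          exact hr'.2 (this ▸ hpa)
        · have : p = q := (Nat.prime_dvd_prime_iff_eq hpp hq).1 h3
          omega
    · have hpU : p ∈ U := Finset.mem_filter.2 ⟨hp, hpa⟩
      have h1 : p ∣ d * ((∏ p ∈ U, p) * q) :=
        Dvd.dvd.mul_left (Dvd.dvd.mul_right (Finset.dvd_prod_of_mem (fun p => p) hpU) _) _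
      exact hpa ((Nat.dvd_add_left h1).1 hdvd)

theorem kanold (a d : ℕ) (h : Nat.Coprime a d) (T : Finset ℕ) (hT : ∀ p ∈ T, p.Prime) (s0 : ℕ) :
    ∃ s, s0 ≤ s ∧ s < s0 + 2 ^ T.card ∧ ∀ p ∈ T, ¬ p ∣ a + d * s := by
  classical
  by_contra hcon
  push Not at hcon
  set ζ : ℕ → ℂ := fun p => Complex.exp (2 * Real.pi * Complex.I / p) with hζ
  have hz : ∀ p ∈ T, ∀ x : ℕ, ζ p ^ x = 1 ↔ p ∣ x := by
    intro p hp x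
    exact (Complex.isPrimitiveRoot_exp p (hT p hp).ne_zero).pow_eq_one_iff_dvd x
  have hexp : ∀ s : ℕ, ∏ p ∈ T, (1 - ζ p ^ (a + d * s)) =
      ∑ t ∈ T.powerset, (∏ p ∈ t, (-(ζ p ^ a))) * (∏ p ∈ t, ζ p ^ d) ^ s := by
    intro s
    have : ∀ p ∈ T, (1 - ζ p ^ (a + d * s)) = (-(ζ p ^ (a + d * s))) + 1 := fun p _ => by ring
    rw [Finset.prod_congr rfl this, Finset.prod_add]
    apply Finset.sum_congr rfl
    intro t _
    rw [Finset.prod_const_one, mul_one, ← Finset.prod_pow, ← Finset.prod_mul_distrib]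
    apply Finset.prod_congr rfl
    intro p _
    rw [pow_add, pow_mul]; ring
  have hvan := recur_vanish T.powerset (fun t => ∏ p ∈ t, (-(ζ p ^ a))) (fun t => ∏ p ∈ t, ζ p ^ d) s0 (by
    intro s h1 h2
    rw [Finset.card_powerset] at h2
    obtain ⟨p, hp, hd⟩ := hcon s h1 h2
    rw [← hexp]
    apply Finset.prod_eq_zero hp
    rw [(hz p hp _).2 hd, sub_self])
  obtain ⟨s, hs, hs2⟩ := ap_coprime a d h T hT s0
  have h3 := hvan s hs
  rw [← hexp, Finset.prod_eq_zero_iff] at h3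
  obtain ⟨p, hp, h4⟩ := h3
  exact hs2 p hp ((hz p hp _).1 (sub_eq_zero.1 h4).symm)

theorem union_sieve (a d : ℕ) (h : Nat.Coprime a d) (T : Finset ℕ) (hT : ∀ p ∈ T, p.Prime) (M : ℕ)
    (hM : ∑ p ∈ T, (M + p - 1) / p < M) : ∃ t, t < M ∧ ∀ p ∈ T, ¬ p ∣ a + d * t := by
  classical
  by_contra hcon
  push Not at hcon
  have hsub : Finset.range M ⊆ T.biUnion (fun p => (Finset.range M).filter (fun t => p ∣ a + d * t)) := by
    intro t ht
    obtain ⟨p, hp, hd⟩ := hcon t (Finset.mem_range.1 ht)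
    exact Finset.mem_biUnion.2 ⟨p, hp, Finset.mem_filter.2 ⟨ht, hd⟩⟩
  have h1 := (Finset.card_le_card hsub).trans Finset.card_biUnion_le
  rw [Finset.card_range] at h1
  have h2 : ∀ p ∈ T, ((Finset.range M).filter (fun t => p ∣ a + d * t)).card ≤ (M + p - 1) / p := by
    intro p hp
    have hpp := hT p hp
    have hppos := hpp.pos
    rw [← Finset.card_range ((M + p - 1) / p)]
    apply Finset.card_le_card_of_injOn (fun t => t / p)
    · intro t ht
      simp only [Finset.coe_filter, Finset.mem_range, Set.mem_ofPred_eq] at ht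
      simp only [Finset.coe_range, Set.mem_Iio]
      rw [Nat.lt_iff_add_one_le, Nat.le_div_iff_mul_le hppos]
      have := Nat.div_mul_le_self t p
      rw [add_mul]; omega
    · intro t ht t' ht' heq
      simp only [Finset.coe_filter, Finset.mem_range, Set.mem_ofPred_eq] at ht ht'
      have hpd : Nat.Coprime p d := by
        rw [hpp.coprime_iff_not_dvd]
        intro hd
        have : p ∣ a := (Nat.dvd_add_left (hd.mul_right t)).1 ht.2
        exact Nat.not_coprime_of_dvd_of_dvd hpp.one_lt this hd h
      have h3 : d * t ≡ d * t' [MOD p] := by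
        have h4 : a + d * t ≡ a + d * t' [MOD p] :=
          ((Nat.modEq_zero_iff_dvd).2 ht.2).trans ((Nat.modEq_zero_iff_dvd).2 ht'.2).symm
        exact Nat.ModEq.add_left_cancel' a h4
      have h5 : t ≡ t' [MOD p] := Nat.ModEq.cancel_left_of_coprime hpd h3
      have e1 := Nat.div_add_mod t p
      have e2 := Nat.div_add_mod t' p
      have heq' : t / p = t' / p := heq
      rw [← e1, ← e2, heq', h5]
  have := h1.trans (Finset.sum_le_sum h2)
  omega

/-- combination of the two sieves: first treat the primes in `U`, then the others. -/
theorem comb_sieve (a d : ℕ) (h : Nat.Coprime a d) (U T : Finset ℕ) (hU : ∀ p ∈ U, p.Prime)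
    (hT : ∀ p ∈ T, p.Prime) (hd : Disjoint U T) (M s0 : ℕ)
    (hM : ∑ p ∈ T, (M + p - 1) / p < M) :
    ∃ s, s0 ≤ s ∧ s < s0 + (∏ p ∈ U, p) * (M - 1) + 2 ^ U.card ∧ ∀ p ∈ U ∪ T, ¬ p ∣ a + d * s := by
  classical
  obtain ⟨s1, h1, h2, h3⟩ := kanold a d h U hU s0
  have hco : Nat.Coprime (a + d * s1) (d * ∏ p ∈ U, p) := by
    apply Nat.Coprime.mul_right
    · simpa using h
    · apply Nat.Coprime.prod_right
      intro p hp
      exact ((hU p hp).coprime_iff_not_dvd.2 (h3 p hp)).symm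
  obtain ⟨t, ht, ht2⟩ := union_sieve _ _ hco T hT M hM
  refine ⟨s1 + (∏ p ∈ U, p) * t, by omega, ?_, ?_⟩
  · have : (∏ p ∈ U, p) * t ≤ (∏ p ∈ U, p) * (M - 1) := Nat.mul_le_mul_left _ (by omega)
    omega
  · have e : a + d * (s1 + (∏ p ∈ U, p) * t) = a + d * s1 + d * (∏ p ∈ U, p) * t := by ring
    intro p hp
    rw [e]
    rcases Finset.mem_union.1 hp with hp | hp
    · intro hdv
      have : p ∣ d * (∏ p ∈ U, p) * t :=
        ((Finset.dvd_prod_of_mem (fun p => p) hp).mul_left d).mul_right t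
      exact h3 p hp ((Nat.dvd_add_left this).1 hdv)
    · exact ht2 p hp

/-- the primes from `5` on, cut off at `31` -/
def qq : ℕ → ℕ
  | 0 => 5 | 1 => 7 | 2 => 11 | 3 => 13 | 4 => 17 | 5 => 19 | 6 => 23 | 7 => 29 | _ => 31

theorem qq_max (T : Finset ℕ) (hT : ∀ p ∈ T, p.Prime) (h5 : ∀ p ∈ T, 5 ≤ p) (c : ℕ) (hc : T.card = c + 1) :
    ∃ p ∈ T, qq c ≤ p := by
  by_contra hcon
  push Not at hcon
  have key : ∀ b k : ℕ, ((Finset.range b).filter (fun p => p.Prime ∧ 5 ≤ p)).card ≤ k →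
      (∀ p ∈ T, p < b) → T.card ≤ k := by
    intro b k h1 h2
    refine (Finset.card_le_card ?_).trans h1
    intro p hp
    exact Finset.mem_filter.2 ⟨Finset.mem_range.2 (h2 p hp), hT p hp, h5 p hp⟩
  rcases c with _ | _ | _ | _ | _ | _ | _ | _ | c
  · have := key 5 0 (by decide) hcon; omega
  · have := key 7 1 (by decide) hcon; omega
  · have := key 11 2 (by decide) hcon; omega
  · have := key 13 3 (by decide) hcon; omega
  · have := key 17 4 (by decide) hcon; omega
  · have := key 19 5 (by decide +kernel) hcon; omega
  · have := key 23 6 (by decide +kernel) hcon; omega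
  · have := key 29 7 (by decide +kernel) hcon; omega
  · have := key 31 8 (by decide +kernel) hcon; omega

theorem qq_sum (g : ℕ → ℕ) (hg : ∀ x y, 5 ≤ x → x ≤ y → g y ≤ g x) (c : ℕ) :
    ∀ (T : Finset ℕ) (_ : ∀ p ∈ T, p.Prime) (_ : ∀ p ∈ T, 5 ≤ p) (_ : T.card = c),
    ∑ p ∈ T, g p ≤ ∑ i ∈ Finset.range c, g (qq i) := by
  classical
  induction c with
  | zero => intro T _ _ hc; rw [Finset.card_eq_zero.1 hc]; simp
  | succ c ih =>
    intro T hT h5 hc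
    obtain ⟨p, hp, hq⟩ := qq_max T hT h5 c hc
    rw [← Finset.sum_erase_add T _ hp, Finset.sum_range_succ]
    have h1 := ih (T.erase p) (fun r hr => hT r (Finset.mem_of_mem_erase hr))
      (fun r hr => h5 r (Finset.mem_of_mem_erase hr)) (by rw [Finset.card_erase_of_mem hp, hc]; rfl)
    have h2 : g p ≤ g (qq c) := hg _ _ (by unfold qq; split <;> norm_num) hq
    omega

theorem qq_prod (c : ℕ) :
    ∀ (T : Finset ℕ) (_ : ∀ p ∈ T, p.Prime) (_ : ∀ p ∈ T, 5 ≤ p) (_ : T.card = c),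
    ∏ i ∈ Finset.range c, qq i ≤ ∏ p ∈ T, p := by
  classical
  induction c with
  | zero => intro T _ _ hc; rw [Finset.card_eq_zero.1 hc]; simp
  | succ c ih =>
    intro T hT h5 hc
    obtain ⟨p, hp, hq⟩ := qq_max T hT h5 c hc
    rw [← Finset.prod_erase_mul T _ hp, Finset.prod_range_succ]
    have h1 := ih (T.erase p) (fun r hr => hT r (Finset.mem_of_mem_erase hr))
      (fun r hr => h5 r (Finset.mem_of_mem_erase hr)) (by rw [Finset.card_erase_of_mem hp, hc]; rfl)
    exact Nat.mul_le_mul h1 hq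

theorem qq_prod_big (c : ℕ) (hc : 9 ≤ c) : 200 * 8 ^ c ≤ ∏ i ∈ Finset.range c, qq i := by
  induction c, hc using Nat.le_induction with
  | base => decide
  | succ c hc ih =>
    rw [Finset.prod_range_succ]
    have : qq c = 31 := by
      obtain ⟨k, rfl⟩ := Nat.exists_eq_add_of_le hc
      rw [add_comm]; rfl
    rw [this, pow_succ]; omega

theorem big_sieve (P : ℕ) (hP : 57 ≤ P) (T : Finset ℕ) (hT : ∀ p ∈ T, p.Prime)
    (H : 2 * ∏ p ∈ T, p ≤ P ^ 3 ∨ (2 ∉ T ∧ ∏ p ∈ T, p ≤ P ^ 3))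
    (a d s0 : ℕ) (h : Nat.Coprime a d) :
    ∃ s, s0 ≤ s ∧ s < s0 + (P - 1) / 2 ∧ ∀ p ∈ T, ¬ p ∣ a + d * s := by
  classical
  set U := T.filter (fun p => p < 5) with hU
  set V := T.filter (fun p => ¬ p < 5) with hV
  have hUV : U ∪ V = T := Finset.filter_union_filter_not_eq _ _
  have hdis : Disjoint U V := Finset.disjoint_filter_filter_not _ _ _
  have hUp : ∀ p ∈ U, p.Prime := fun p hp => hT p (Finset.mem_filter.1 hp).1
  have hVp : ∀ p ∈ V, p.Prime := fun p hp => hT p (Finset.mem_filter.1 hp).1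
  have hV5 : ∀ p ∈ V, 5 ≤ p := fun p hp => by have := (Finset.mem_filter.1 hp).2; omega
  have hprod : ∏ p ∈ T, p = (∏ p ∈ U, p) * ∏ p ∈ V, p := by
    rw [← hUV, Finset.prod_union hdis]
  have hUcase : (U = ∅ ∨ U = {3}) ∨ (2 ∈ T ∧ (U = {2} ∨ U = {2, 3})) := by
    have h0 : U ⊆ {2, 3} := by
      intro p hp
      have h1 := (Finset.mem_filter.1 hp).2
      have h2 := hUp p hp
      interval_cases p <;> revert h2 <;> decide
    by_cases h2 : 2 ∈ U <;> by_cases h3 : 3 ∈ U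
    · right; refine ⟨(Finset.mem_filter.1 h2).1, Or.inr ?_⟩
      apply Finset.Subset.antisymm h0
      intro p hp; simp at hp; rcases hp with rfl | rfl <;> assumption
    · right; refine ⟨(Finset.mem_filter.1 h2).1, Or.inl ?_⟩
      ext p; constructor
      · intro hp; have := h0 hp; simp at this ⊢; rcases this with rfl | rfl
        · rfl
        · exact absurd hp h3
      · intro hp; simp at hp; subst hp; exact h2
    · left; right
      ext p; constructor
      · intro hp; have := h0 hp; simp at this ⊢; rcases this with rfl | rfl
        · exact absurd hp h2
        · rfl
      · intro hp; simp at hp; subst hp; exact h3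
    · left; left
      ext p; constructor
      · intro hp; have := h0 hp; simp at this ⊢; rcases this with rfl | rfl
        · exact absurd hp h2
        · exact absurd hp h3
      · intro hp; simp at hp
  obtain ⟨u, e, hue, hcU, hUprod⟩ : ∃ u e : ℕ, ((u = 0 ∧ e = 1 ∧ e * ∏ p ∈ V, p ≤ P ^ 3) ∨
      (u = 1 ∧ e = 3 ∧ e * ∏ p ∈ V, p ≤ P ^ 3) ∨
      (u = 1 ∧ e = 2 ∧ 2 * (e * ∏ p ∈ V, p) ≤ P ^ 3) ∨ (u = 2 ∧ e = 6 ∧ 2 * (e * ∏ p ∈ V, p) ≤ P ^ 3)) ∧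
      U.card = u ∧ ∏ p ∈ U, p = e := by
    have H2 : (∏ p ∈ U, p) * ∏ p ∈ V, p ≤ P ^ 3 := by
      rw [← hprod]; rcases H with H | H
      · omega
      · exact H.2
    rcases hUcase with (h1 | h1) | ⟨h2, h1 | h1⟩
    · exact ⟨0, 1, Or.inl ⟨rfl, rfl, by rw [h1] at H2; simpa using H2⟩, by rw [h1]; rfl, by rw [h1]; rfl⟩
    · exact ⟨1, 3, Or.inr (Or.inl ⟨rfl, rfl, by rw [h1] at H2; simpa using H2⟩), by rw [h1]; rfl, by rw [h1]; rfl⟩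
    · have H3 : 2 * ∏ p ∈ T, p ≤ P ^ 3 := by
        rcases H with H | H
        · exact H
        · exact absurd h2 H.1
      rw [hprod, h1] at H3
      exact ⟨1, 2, Or.inr (Or.inr (Or.inl ⟨rfl, rfl, by simpa using H3⟩)), by rw [h1]; rfl, by rw [h1]; rfl⟩
    · have H3 : 2 * ∏ p ∈ T, p ≤ P ^ 3 := by
        rcases H with H | H
        · exact H
        · exact absurd h2 H.1
      rw [hprod, h1] at H3
      exact ⟨2, 6, Or.inr (Or.inr (Or.inr ⟨rfl, rfl, by simpa using H3⟩)), by rw [h1]; rfl, by rw [h1]; rfl⟩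
  have hpr := qq_prod V.card V hVp hV5 rfl
  have hsum := fun M => qq_sum (fun p => (M + p - 1) / p) (fun x y hx hxy => by
    have h1 : (M + x - 1) / x = (M - 1 + x) / x ∨ M = 0 := by
      rcases Nat.eq_zero_or_pos M with h | h
      · right; exact h
      · left; congr 1; omega
    rcases Nat.eq_zero_or_pos M with h | h
    · subst h
      simp only [zero_add]
      rw [Nat.div_eq_of_lt (by omega)]; exact Nat.zero_le _
    · have e1 : M + x - 1 = (M - 1) + x := by omega
      have e2 : M + y - 1 = (M - 1) + y := by omega
      simp only [e1, e2]
      rw [Nat.add_div_right _ (by omega), Nat.add_div_right _ (by omega)]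
      exact Nat.succ_le_succ (Nat.div_le_div_left hxy (by omega))) V.card V hVp hV5 rfl
  -- finishing by the combined sieve
  have fin : ∀ M, ∑ i ∈ Finset.range V.card, (M + qq i - 1) / qq i < M →
      e * (M - 1) + 2 ^ u ≤ (P - 1) / 2 →
      ∃ s, s0 ≤ s ∧ s < s0 + (P - 1) / 2 ∧ ∀ p ∈ T, ¬ p ∣ a + d * s := by
    intro M h1 h2
    obtain ⟨s, hs1, hs2, hs3⟩ := comb_sieve a d h U V hUp hVp hdis M s0 ((hsum M).trans_lt h1)
    rw [hUprod, hcU] at hs2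
    rw [hUV] at hs3
    exact ⟨s, hs1, by omega, hs3⟩
  have hPle : ∀ B : ℕ, P ≤ B → P ^ 3 ≤ B ^ 3 := fun B hB => Nat.pow_le_pow_left hB 3
  generalize hc : V.card = c at *
  by_cases h4 : c ≤ 4
  · apply fin 5
    · interval_cases c <;> decide
    · rcases hue with ⟨rfl, rfl, _⟩ | ⟨rfl, rfl, _⟩ | ⟨rfl, rfl, _⟩ | ⟨rfl, rfl, _⟩ <;> omega
  by_cases h5 : c = 5
  · subst h5
    have hpr' : 85085 ≤ ∏ p ∈ V, p := le_trans (by decide) hpr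
    apply fin 7 (by decide)
    rcases hue with ⟨rfl, rfl, _⟩ | ⟨rfl, rfl, _⟩ | ⟨rfl, rfl, _⟩ | ⟨rfl, rfl, hh⟩
    · omega
    · omega
    · omega
    · by_contra hcon
      have := hPle 90 (by omega)
      omega
  by_cases h7 : c ≤ 7
  · have hpr' : 1616615 ≤ ∏ p ∈ V, p := by
      refine le_trans ?_ hpr
      interval_cases c
      · omega
      · decide
      · decide
    have hP2 : 117 < P := by
      by_contra hcon
      have := hPle 117 (by omega)
      rcases hue with ⟨rfl, rfl, _⟩ | ⟨rfl, rfl, _⟩ | ⟨rfl, rfl, _⟩ | ⟨rfl, rfl, hh⟩ <;> omega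
    apply fin 10
    · interval_cases c <;> first | omega | decide
    · rcases hue with ⟨rfl, rfl, _⟩ | ⟨rfl, rfl, _⟩ | ⟨rfl, rfl, _⟩ | ⟨rfl, rfl, _⟩ <;> omega
  by_cases h8 : c = 8
  · subst h8
    have hpr' : 1000000000 ≤ ∏ p ∈ V, p := le_trans (by decide) hpr
    have hP2 : 900 < P := by
      by_contra hcon
      have := hPle 900 (by omega)
      rcases hue with ⟨rfl, rfl, _⟩ | ⟨rfl, rfl, _⟩ | ⟨rfl, rfl, _⟩ | ⟨rfl, rfl, hh⟩ <;> omega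
    apply fin 13 (by decide)
    rcases hue with ⟨rfl, rfl, _⟩ | ⟨rfl, rfl, _⟩ | ⟨rfl, rfl, _⟩ | ⟨rfl, rfl, _⟩ <;> omega
  have hpr' := (qq_prod_big c (by omega)).trans hpr
  obtain ⟨s, hs1, hs2, hs3⟩ := kanold a d h T hT s0
  refine ⟨s, hs1, lt_of_lt_of_le hs2 ?_, hs3⟩
  have hTc : T.card = u + c := by
    rw [← hUV, Finset.card_union_of_disjoint hdis, hcU, hc]
  rw [hTc]
  by_contra hcon
  have hP3 : P ≤ 2 ^ (u + c + 1) := by rw [pow_succ]; omega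
  have := hPle _ hP3
  have e8 : (2 ^ (u + c + 1)) ^ 3 = 8 * 8 ^ u * 8 ^ c := by
    rw [← pow_mul, show (8:ℕ) = 2 ^ 3 by norm_num, ← pow_mul, ← pow_mul, ← pow_add, ← pow_add]
    congr 1; ring
  rw [e8] at this
  have hpos : 0 < 8 ^ c := by positivity
  rcases hue with ⟨rfl, rfl, _⟩ | ⟨rfl, rfl, _⟩ | ⟨rfl, rfl, _⟩ | ⟨rfl, rfl, hh⟩ <;> omega

/-- the test of one candidate -/
def tst (e P Q S t X : ℕ) : Bool :=
  cond (cond (Nat.beq e 1) true (Nat.beq (Nat.mod X 2) 1))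
    (Nat.beq (Nat.gcd X (Nat.mul P (Nat.mod (Nat.add (Nat.add (Nat.mul Q X) P)
      (Nat.mul (Nat.mul (Nat.mul 2 t) P) Q)) (Nat.mul (Nat.mul (Nat.mul e P) Q) S)))) 1) false

/-- bounded universal quantifier, as a recursor -/
def allB (f : ℕ → Bool) (n : ℕ) : Bool :=
  Nat.rec true (fun k ih => cond (f k) ih false) n

/-- bounded existential quantifier, as a recursor -/
def exB (f : ℕ → Bool) (n : ℕ) : Bool :=
  Nat.rec false (fun k ih => cond (f k) true ih) n

def chkX (e P Q S t : ℕ) : Bool :=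
  exB (fun s => tst e P Q S t (Nat.add (Nat.mod (Nat.mul (Nat.sub S t) P) S) (Nat.mul S s))) (Nat.mul e P)

def chkP (Q S t P : ℕ) : Bool :=
  cond (Nat.ble P Q) true (cond (Nat.ble P S) true
    (cond (Nat.beq (Nat.gcd P (Nat.mul Q S)) 1)
      (cond (chkX 1 P Q S t) (cond (Nat.beq (Nat.mod (Nat.mul P Q) 2) 1) true (chkX 2 P Q S t)) false)
      true))

def chkT (Q S t : ℕ) : Bool :=
  cond (Nat.beq (Nat.mod (Nat.add (Nat.mul t Q) 1) S) 0) (allB (chkP Q S t) 57) true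

def chkQ (S Q : ℕ) : Bool :=
  cond (Nat.ble Q 1) true (allB (chkT Q S) S)

def chkS (S : ℕ) : Bool :=
  cond (Nat.ble S 2) true (cond (Nat.beq (Nat.mod S 2) 0) true (allB (chkQ S) 56))

theorem chk_ok : allB chkS 56 = true := by decide +kernel

theorem allB_spec (f : ℕ → Bool) (n : ℕ) (h : allB f n = true) : ∀ k, k < n → f k = true := by
  induction n with
  | zero => intro k hk; omega
  | succ n ih =>
    have h' : cond (f n) (allB f n) false = true := h
    intro k hk
    cases hf : f n with
    | false => rw [hf] at h'; exact absurd h' (by simp)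
    | true =>
      rw [hf] at h'
      rcases Nat.lt_succ_iff_lt_or_eq.1 hk with h1 | h1
      · exact ih h' k h1
      · rw [h1]; exact hf

theorem exB_spec (f : ℕ → Bool) (n : ℕ) (h : exB f n = true) : ∃ k, k < n ∧ f k = true := by
  induction n with
  | zero => exact absurd h (by simp [exB])
  | succ n ih =>
    have h' : cond (f n) true (exB f n) = true := h
    cases hf : f n with
    | true => exact ⟨n, by omega, hf⟩
    | false =>
      rw [hf] at h'
      obtain ⟨k, hk, hk2⟩ := ih h'
      exact ⟨k, by omega, hk2⟩

theorem inv_exists (Q S : ℕ) (hS : 1 < S) (c3 : Nat.Coprime Q S) :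
    ∃ t, t < S ∧ (t * Q + 1) % S = 0 := by
  obtain ⟨m, hm⟩ := Nat.exists_mul_mod_eq_one_of_coprime c3 hS
  refine ⟨((S - 1) * m) % S, Nat.mod_lt _ (by omega), ?_⟩
  have h1 : ((S - 1) * m) % S * Q + 1 ≡ (S - 1) * m * Q + 1 [MOD S] :=
    ((Nat.mod_modEq _ _).mul_right _).add_right _
  have h2 : (S - 1) * m * Q + 1 ≡ (S - 1) * 1 + 1 [MOD S] := by
    have : Q * m ≡ 1 [MOD S] := by
      rw [Nat.ModEq, hm.2, Nat.mod_eq_of_lt hS]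
    have := (this.mul_left (S - 1)).add_right 1
    convert this using 1; ring
  have h3 := h1.trans h2
  have h4 : (S - 1) * 1 + 1 = S := by omega
  rw [h4, Nat.ModEq, Nat.mod_self] at h3
  exact h3

/-- the conclusion of the number theoretic lemma -/
def NTConc (e P Q S : ℕ) : Prop :=
  ∃ X k : ℕ, 0 < X ∧ Q * X < e * P * Q * S ∧ 0 < k ∧ k < e * P * Q * S ∧ Q * X ≡ P [MOD S] ∧
    S ∣ k ∧ ((e * P * Q : ℕ) : ℤ) ∣ (Q * X + P - k : ℤ) ∧ (e = 2 → X % 2 = 1) ∧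
    Nat.Coprime X P ∧ Nat.Coprime X k

theorem baseX (P Q S t : ℕ) (ht : t < S) (htq : (t * Q + 1) % S = 0) :
    Q * ((S - t) * P % S) ≡ P [MOD S] := by
  have h1 : Q * ((S - t) * P % S) ≡ Q * ((S - t) * P) [MOD S] := (Nat.mod_modEq _ _).mul_left _
  refine h1.trans ?_
  rw [Nat.modEq_iff_dvd]
  have h2 : (S : ℤ) ∣ t * Q + 1 := by
    have := Nat.dvd_of_mod_eq_zero htq
    exact_mod_cast this
  obtain ⟨c, hc⟩ := h2
  push_cast [Nat.cast_sub ht.le]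
  refine ⟨c * P - Q * P, ?_⟩
  linear_combination (P : ℤ) * hc

theorem nt_small (e P Q S : ℕ) (he : e = 1 ∨ e = 2) (hQ : 2 ≤ Q) (hS : 3 ≤ S) (hSo : S % 2 = 1)
    (hPQ : Q < P) (hPS : S < P) (c1 : Nat.Coprime P Q) (c2 : Nat.Coprime P S) (c3 : Nat.Coprime Q S)
    (hev : e = 2 → P * Q % 2 = 0) (hP : P < 57) : NTConc e P Q S := by
  obtain ⟨t, ht, htq⟩ := inv_exists Q S (by omega) c3
  have h1 := allB_spec _ _ chk_ok S (by omega)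
  unfold chkS at h1
  rw [show Nat.ble S 2 = false by rw [← Bool.not_eq_true, Nat.ble_eq]; omega, cond_false,
    show Nat.beq (Nat.mod S 2) 0 = false by
      change Nat.beq (S % 2) 0 = false; rw [hSo]; rfl, cond_false] at h1
  have h2 := allB_spec _ _ h1 Q (by omega)
  unfold chkQ at h2
  rw [show Nat.ble Q 1 = false by rw [← Bool.not_eq_true, Nat.ble_eq]; omega, cond_false] at h2
  have h3 := allB_spec _ _ h2 t ht
  unfold chkT at h3
  rw [show Nat.beq (Nat.mod (Nat.add (Nat.mul t Q) 1) S) 0 = true by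
      change Nat.beq ((t * Q + 1) % S) 0 = true; rw [htq]; rfl, cond_true] at h3
  have h4 := allB_spec _ _ h3 P hP
  unfold chkP at h4
  rw [show Nat.ble P Q = false by rw [← Bool.not_eq_true, Nat.ble_eq]; omega, cond_false,
    show Nat.ble P S = false by rw [← Bool.not_eq_true, Nat.ble_eq]; omega, cond_false,
    show Nat.beq (Nat.gcd P (Nat.mul Q S)) 1 = true by
      change Nat.beq (Nat.gcd P (Q * S)) 1 = true
      rw [show Nat.gcd P (Q * S) = 1 from Nat.Coprime.mul_right c1 c2]; rfl, cond_true] at h4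
  have h5 : chkX e P Q S t = true := by
    cases hx : chkX 1 P Q S t with
    | false => rw [hx] at h4; exact absurd h4 (by simp)
    | true =>
      rw [hx, cond_true] at h4
      rcases he with rfl | rfl
      · exact hx
      · have := hev rfl
        rw [show Nat.beq (Nat.mod (Nat.mul P Q) 2) 1 = false by
          change Nat.beq (P * Q % 2) 1 = false; rw [this]; rfl, cond_false] at h4
        exact h4
  obtain ⟨s, hs, h6⟩ := exB_spec _ _ h5
  have hs' : s < e * P := hs
  set b := (S - t) * P % S with hb
  have hbS : b < S := Nat.mod_lt _ (by omega)
  have hbX : Q * b ≡ P [MOD S] := baseX P Q S t ht htq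
  set X := b + S * s with hX
  have h7 : tst e P Q S t X = true := h6
  unfold tst at h7
  have h8 : (e = 2 → X % 2 = 1) ∧
      Nat.beq (Nat.gcd X (P * ((Q * X + P + 2 * t * P * Q) % (e * P * Q * S)))) 1 = true := by
    cases hx : cond (Nat.beq e 1) true (Nat.beq (Nat.mod X 2) 1) with
    | false => rw [hx] at h7; exact absurd h7 (by simp)
    | true =>
      rw [hx, cond_true] at h7
      refine ⟨?_, h7⟩
      rintro rfl
      exact Nat.eq_of_beq_eq_true hx
  obtain ⟨hodd, h9⟩ := h8
  have h10 := Nat.eq_of_beq_eq_true h9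
  set n := e * P * Q * S with hn
  have hepos : 0 < e := by rcases he with rfl | rfl <;> norm_num
  have hnpos : 0 < n := by rw [hn]; apply Nat.mul_pos (Nat.mul_pos (Nat.mul_pos hepos _) _) <;> omega
  set k := (Q * X + P + 2 * t * P * Q) % n with hk
  have hcop : Nat.Coprime X (P * k) := h10
  have hXP : Nat.Coprime X P := hcop.coprime_mul_right_right
  have hXk : Nat.Coprime X k := hcop.coprime_mul_left_right
  have hSt : (S : ℤ) ∣ t * Q + 1 := by exact_mod_cast Nat.dvd_of_mod_eq_zero htq
  have hXm : Q * X ≡ P [MOD S] := by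
    have : Q * X = Q * b + S * (Q * s) := by rw [hX]; ring
    rw [this]
    exact (Nat.ModEq.add_right _ hbX).trans (by simp [Nat.ModEq])
  obtain ⟨g, hg⟩ : ∃ g : ℕ, Q * X + P + 2 * t * P * Q = k + n * g :=
    ⟨_, (Nat.mod_add_div _ _).symm⟩
  have hSk : S ∣ k := by
    have h11 : (S : ℤ) ∣ k := by
      have hA : (S : ℤ) ∣ P - Q * X := by
        have := (Nat.modEq_iff_dvd).1 hXm
        exact_mod_cast this
      obtain ⟨c, hc⟩ := hA
      obtain ⟨c', hc'⟩ := hSt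
      have hgz : (Q * X + P + 2 * t * P * Q : ℤ) = k + n * g := by exact_mod_cast hg
      have hnz : (n : ℤ) = e * P * Q * S := by rw [hn]; push_cast; ring
      refine ⟨-c + 2 * P * c' - e * P * Q * g, ?_⟩
      rw [hnz] at hgz
      linear_combination -hgz - hc + 2 * (P : ℤ) * hc'
    exact_mod_cast h11
  have hdv : ((e * P * Q : ℕ) : ℤ) ∣ (Q * X + P - k : ℤ) := by
    have hgz : (Q * X + P + 2 * t * P * Q : ℤ) = k + n * g := by exact_mod_cast hg
    have hnz : (n : ℤ) = e * P * Q * S := by rw [hn]; push_cast; ring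
    rw [hnz] at hgz
    rcases he with rfl | rfl
    · refine ⟨S * g - 2 * t, ?_⟩
      push_cast at hgz ⊢
      linear_combination hgz
    · refine ⟨S * g - t, ?_⟩
      push_cast at hgz ⊢
      linear_combination hgz
  refine ⟨X, k, ?_, ?_, ?_, Nat.mod_lt _ hnpos, hXm, hSk, hdv, hodd, hXP, hXk⟩
  · rcases Nat.eq_zero_or_pos X with h0 | h0
    · rw [h0] at hXP
      have := (Nat.coprime_zero_left _).1 hXP
      omega
    · exact h0
  · have hXlt : X < S * (e * P) := by
      have : S * (s + 1) ≤ S * (e * P) := Nat.mul_le_mul_left _ hs'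
      rw [mul_add, mul_one] at this
      omega
    calc Q * X < Q * (S * (e * P)) := Nat.mul_lt_mul_of_pos_left hXlt (by omega)
      _ = n := by rw [hn]; ring
  · rcases Nat.eq_zero_or_pos k with h0 | h0
    · exfalso
      rw [h0] at hdv
      have hQd : (Q : ℤ) ∣ P := by
        obtain ⟨c, hc⟩ := hdv
        refine ⟨e * P * c - X, ?_⟩
        push_cast at hc
        linear_combination hc
      have hQd' : Q ∣ P := by exact_mod_cast hQd
      have := Nat.Coprime.eq_one_of_dvd c1.symm hQd'
      omega
    · exact h0

theorem nt_R (e Q S : ℕ) (he : e = 1 ∨ e = 2) (hS : 3 ≤ S) (hSo : S % 2 = 1) (c3 : Nat.Coprime Q S) :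
    ∃ R : ℤ, (e : ℤ) ∣ R ∧ (S : ℤ) ∣ R * Q + 2 ∧ 2 * R ≤ e * (S - 1) ∧ -(2 * R) ≤ e * (S - 1) := by
  obtain ⟨t, ht, htq⟩ := inv_exists Q S (by omega) c3
  have hSt : (S : ℤ) ∣ t * Q + 1 := by exact_mod_cast Nat.dvd_of_mod_eq_zero htq
  have bal : ∀ x : ℤ, ∃ r : ℤ, (S : ℤ) ∣ r - x ∧ 2 * r ≤ S - 1 ∧ -(2 * r) ≤ S - 1 := by
    intro x
    have h1 := Int.emod_nonneg x (b := (S : ℤ)) (by omega)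
    have h2 := Int.emod_lt_of_pos x (b := (S : ℤ)) (by omega)
    have h3 := Int.emod_add_mul_ediv x S
    by_cases h : 2 * (x % S) ≤ S - 1
    · exact ⟨x % S, ⟨-(x / S), by linear_combination h3⟩, h, by omega⟩
    · exact ⟨x % S - S, ⟨-(x / S) - 1, by linear_combination h3⟩, by omega, by omega⟩
  obtain ⟨c, hc⟩ := hSt
  rcases he with rfl | rfl
  · obtain ⟨r, ⟨g, hg⟩, h2, h3⟩ := bal (2 * t)
    refine ⟨r, by simp, ⟨g * Q + 2 * c, ?_⟩, by push_cast; omega, by push_cast; omega⟩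
    linear_combination (Q : ℤ) * hg + 2 * hc
  · obtain ⟨r, ⟨g, hg⟩, h2, h3⟩ := bal t
    refine ⟨2 * r, by simp, ⟨2 * g * Q + 2 * c, ?_⟩, by push_cast; omega, by push_cast; omega⟩
    linear_combination 2 * (Q : ℤ) * hg + 2 * hc

set_option maxHeartbeats 2000000 in
theorem nt_big (e P Q S : ℕ) (he : e = 1 ∨ e = 2) (hQ : 2 ≤ Q) (hS : 3 ≤ S) (hSo : S % 2 = 1)
    (hPQ : Q < P) (hPS : S < P) (c1 : Nat.Coprime P Q) (c2 : Nat.Coprime P S) (c3 : Nat.Coprime Q S)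
    (hP : 57 ≤ P) : NTConc e P Q S := by
  classical
  have hepos : 0 < e := by rcases he with rfl | rfl <;> norm_num
  obtain ⟨t, ht, htq⟩ := inv_exists Q S (by omega) c3
  obtain ⟨R, ⟨R', heR⟩, ⟨g, hSR⟩, hR1, hR2⟩ := nt_R e Q S he hS hSo c3
  -- the base point
  obtain ⟨a, ha, haS, haodd⟩ : ∃ a, Q * a ≡ P [MOD S] ∧ a < e * S ∧ (e = 2 → a % 2 = 1) := by
    have hb := baseX P Q S t ht htq
    have hbS : (S - t) * P % S < S := Nat.mod_lt _ (by omega)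
    generalize (S - t) * P % S = b at hb hbS
    rcases he with rfl | rfl
    · exact ⟨b, hb, by omega, by omega⟩
    · by_cases hb2 : b % 2 = 1
      · exact ⟨b, hb, by omega, fun _ => hb2⟩
      · refine ⟨b + S, ?_, by omega, fun _ => by omega⟩
        rw [mul_add]
        exact (hb.add_right _).trans (by simp [Nat.ModEq])
  have haSc : Nat.Coprime a S := by
    have h1 : Nat.Coprime (Q * a) S := by
      rw [Nat.Coprime, Nat.ModEq.gcd_eq ha]; exact c2
    exact h1.coprime_mul_left
  have hac : Nat.Coprime a (e * S) := by
    apply Nat.Coprime.mul_right _ haSc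
    rcases he with rfl | rfl
    · simp
    · rw [Nat.coprime_two_right, Nat.odd_iff]; exact haodd rfl
  set w : ℤ := 1 + R * Q with hw
  have hw0 : w ≠ 0 := by
    intro h0
    have : (Q : ℤ) ∣ 1 := ⟨-R, by linear_combination h0⟩
    have := Int.le_of_dvd one_pos this
    omega
  have hQS : (0 : ℤ) < e * Q * S := by
    have : 0 < e * Q * S := Nat.mul_pos (Nat.mul_pos hepos (by omega)) (by omega)
    exact_mod_cast this
  have heQ : (2 : ℤ) ≤ e * Q := by
    have : 1 * 2 ≤ e * Q := Nat.mul_le_mul hepos hQ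
    exact_mod_cast this
  have hwabs : 2 * w.natAbs ≤ e * Q * S := by
    have h1 : 2 * w ≤ e * Q * S := by
      have := mul_le_mul_of_nonneg_right hR1 (show (0 : ℤ) ≤ Q by omega)
      rw [hw]; linarith
    have h2 : -(2 * w) ≤ e * Q * S := by
      have := mul_le_mul_of_nonneg_right hR2 (show (0 : ℤ) ≤ Q by omega)
      rw [hw]; linarith
    have h3 : ((2 * w.natAbs : ℕ) : ℤ) ≤ ((e * Q * S : ℕ) : ℤ) := by
      push_cast
      rcases abs_cases w with ⟨h, _⟩ | ⟨h, _⟩ <;> rw [h] <;> linarith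
    exact_mod_cast h3
  have hm0 : P * w.natAbs ≠ 0 := Nat.mul_ne_zero (by omega) (Int.natAbs_ne_zero.2 hw0)
  have hQS3 : P * (Q * S) ≤ P ^ 3 := by
    rw [show P ^ 3 = P * (P * P) by ring]
    exact Nat.mul_le_mul_left _ (Nat.mul_le_mul hPQ.le hPS.le)
  have hmP : 2 * (P * w.natAbs) ≤ e * P ^ 3 := by
    calc 2 * (P * w.natAbs) = P * (2 * w.natAbs) := by ring
      _ ≤ P * (e * Q * S) := Nat.mul_le_mul_left _ hwabs
      _ = e * (P * (Q * S)) := by ring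
      _ ≤ e * P ^ 3 := Nat.mul_le_mul_left _ hQS3
  obtain ⟨T, hTp, hTall, HT⟩ : ∃ T : Finset ℕ, (∀ p ∈ T, p.Prime) ∧
      (∀ p, p.Prime → p ∣ P * w.natAbs → p ∈ T ∨ (p = 2 ∧ e = 2)) ∧
      (2 * ∏ p ∈ T, p ≤ P ^ 3 ∨ (2 ∉ T ∧ ∏ p ∈ T, p ≤ P ^ 3)) := by
    have hle : ∏ p ∈ (P * w.natAbs).primeFactors, p ≤ P * w.natAbs :=
      Nat.le_of_dvd (Nat.pos_of_ne_zero hm0) (Nat.prod_primeFactors_dvd _)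
    rcases he with rfl | rfl
    · refine ⟨(P * w.natAbs).primeFactors, fun p hp => Nat.prime_of_mem_primeFactors hp,
        fun p hp hd => Or.inl (Nat.mem_primeFactors.2 ⟨hp, hd, hm0⟩), Or.inl ?_⟩
      omega
    · refine ⟨(P * w.natAbs).primeFactors.erase 2,
        fun p hp => Nat.prime_of_mem_primeFactors (Finset.mem_of_mem_erase hp), ?_, Or.inr ⟨by simp, ?_⟩⟩
      · intro p hp hd
        by_cases h2 : p = 2
        · exact Or.inr ⟨h2, rfl⟩
        · exact Or.inl (Finset.mem_erase.2 ⟨h2, Nat.mem_primeFactors.2 ⟨hp, hd, hm0⟩⟩)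
      · have : ∏ p ∈ (P * w.natAbs).primeFactors.erase 2, p ≤ ∏ p ∈ (P * w.natAbs).primeFactors, p := by
          apply Finset.prod_le_prod_of_subset_of_one_le' (Finset.erase_subset _ _)
          intro p hp _
          exact (Nat.prime_of_mem_primeFactors hp).one_lt.le
        omega
  have hnz : ((e * P * Q * S : ℕ) : ℤ) = e * P * Q * S := by push_cast; ring
  have hQ2 : (2 : ℤ) ≤ Q := by exact_mod_cast hQ
  have hPp : (57 : ℤ) ≤ P := by exact_mod_cast hP
  -- finishing, given the size conditions
  have fin : ∀ s : ℕ, s < P → (∀ p ∈ T, ¬ p ∣ a + e * S * s) →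
      0 < (Q * (a + e * S * s : ℕ) + P + R * P * Q : ℤ) →
      (Q * (a + e * S * s : ℕ) + P + R * P * Q : ℤ) < e * P * Q * S → NTConc e P Q S := by
    intro s hsP hs hk1 hk2
    set X := a + e * S * s with hX
    obtain ⟨k, hk⟩ := Int.eq_ofNat_of_zero_le hk1.le
    have hXm : Q * X ≡ P [MOD S] := by
      have : Q * X = Q * a + S * (Q * e * s) := by rw [hX]; ring
      rw [this]
      exact (Nat.ModEq.add_right _ ha).trans (by simp [Nat.ModEq])
    have hXodd : e = 2 → X % 2 = 1 := by
      intro h; have := haodd h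
      rw [hX, h, show a + 2 * S * s = a + 2 * (S * s) by ring]; omega
    have hprime : ∀ p, p.Prime → p ∣ X → ¬ p ∣ P * w.natAbs := by
      intro p hp hpX hpm
      rcases hTall p hp hpm with h | ⟨h, h'⟩
      · exact hs p h hpX
      · have := hXodd h'
        subst h; omega
    have hXP : Nat.Coprime X P :=
      Nat.coprime_of_dvd (fun p hp h1 h2 => hprime p hp h1 (h2.mul_right _))
    have hXk : Nat.Coprime X k := by
      apply Nat.coprime_of_dvd
      intro p hp h1 h2
      have h3 : (p : ℤ) ∣ P * w := by
        have h1z : (p : ℤ) ∣ X := by exact_mod_cast h1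
        have h2z : (p : ℤ) ∣ k := by exact_mod_cast h2
        have : (P * w : ℤ) = k - Q * X := by
          have hk' : (Q * X + P + R * P * Q : ℤ) = k := hk
          rw [hw]; linear_combination hk'
        rw [this]
        exact dvd_sub h2z (h1z.mul_left _)
      apply hprime p hp h1
      have := Int.natAbs_dvd_natAbs.2 h3
      simpa [Int.natAbs_mul] using this
    have hXlt : X < e * S * P := by
      have : e * S * (s + 1) ≤ e * S * P := Nat.mul_le_mul_left _ hsP
      rw [mul_add, mul_one] at this
      omega
    have hXpos : 0 < X := by
      rcases Nat.eq_zero_or_pos X with h0 | h0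
      · rw [h0] at hXP
        have := (Nat.coprime_zero_left _).1 hXP
        omega
      · exact h0
    have hk' : (Q * X + P + R * P * Q : ℤ) = k := hk
    refine ⟨X, k, hXpos, ?_, ?_, ?_, hXm, ?_, ?_, hXodd, hXP, hXk⟩
    · calc Q * X < Q * (e * S * P) := Nat.mul_lt_mul_of_pos_left hXlt (by omega)
        _ = e * P * Q * S := by ring
    · have : (0 : ℤ) < k := hk' ▸ hk1
      exact_mod_cast this
    · have : (k : ℤ) < e * P * Q * S := hk' ▸ hk2
      exact_mod_cast this
    · have hA : (S : ℤ) ∣ P - Q * X := by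
        have := (Nat.modEq_iff_dvd).1 hXm
        exact_mod_cast this
      obtain ⟨c, hc⟩ := hA
      have : (S : ℤ) ∣ k := ⟨-c + P * g, by linear_combination -hk' - hc + (P : ℤ) * hSR⟩
      exact_mod_cast this
    · refine ⟨-R', ?_⟩
      push_cast
      rw [← hk', heR]; ring
  set N := (P - 1) / 2 with hN
  have hN2 : 2 * N ≤ P - 1 := by omega
  have hE : (1 : ℤ) ≤ e := by exact_mod_cast hepos
  have heS : (0 : ℤ) < e * S := by
    have : 0 < e * S := Nat.mul_pos hepos (by omega)
    exact_mod_cast this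
  have hPQpos : (0 : ℤ) < P * Q := by positivity
  by_cases hR : 0 ≤ R
  · obtain ⟨s, _, hs2, hs3⟩ := big_sieve P hP T hTp HT a (e * S) 0 hac
    apply fin s (by omega) hs3
    · have : (0 : ℤ) ≤ R * P * Q := by positivity
      have : (0 : ℤ) ≤ Q * (a + e * S * s : ℕ) := by positivity
      linarith
    · have hXlt : 2 * ((a + e * S * s : ℕ) : ℤ) ≤ e * S * (P - 1) := by
        have h1 : e * S * (s + 1) ≤ e * S * N := Nat.mul_le_mul_left _ (by omega)
        have h2 : a + e * S * s ≤ e * S * N := by rw [mul_add, mul_one] at h1; omega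
        have h3 : ((a + e * S * s : ℕ) : ℤ) ≤ e * S * N := by exact_mod_cast h2
        have h4 : (2 * N : ℤ) ≤ P - 1 := by omega
        have h5 := mul_le_mul_of_nonneg_left h4 heS.le
        linarith
      have h6 := mul_le_mul_of_nonneg_left hXlt (show (0 : ℤ) ≤ Q by omega)
      have h7 := mul_le_mul_of_nonneg_left hR1 hPQpos.le
      have h8 : (2 : ℤ) * P ≤ e * Q * P := mul_le_mul_of_nonneg_right heQ (by omega)
      have h9 : (0 : ℤ) < Q * (e * S) := by positivity
      linarith
  · have hRlt : R ≤ -1 := by omega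
    obtain ⟨s, hs1, hs2, hs3⟩ := big_sieve P hP T hTp HT a (e * S) (P - N) hac
    have hsP : s < P := by omega
    apply fin s hsP hs3
    · have hXge : e * S * (P + 1) ≤ 2 * ((a + e * S * s : ℕ) : ℤ) := by
        have h4 : (P + 1 : ℤ) ≤ 2 * s := by omega
        have h5 := mul_le_mul_of_nonneg_left h4 heS.le
        push_cast
        have : (0 : ℤ) ≤ a := by positivity
        linarith
      have h6 := mul_le_mul_of_nonneg_left hXge (show (0 : ℤ) ≤ Q by omega)
      have h7 := mul_le_mul_of_nonneg_left hR2 hPQpos.le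
      have h9 : (0 : ℤ) < Q * (e * S) := by positivity
      have h10 : (0 : ℤ) < P * Q * e := by positivity
      linarith
    · have h1 : e * S * (s + 1) ≤ e * S * P := Nat.mul_le_mul_left _ hsP
      have h2 : a + e * S * s ≤ e * S * P := by rw [mul_add, mul_one] at h1; omega
      have h3 : ((a + e * S * s : ℕ) : ℤ) ≤ e * S * P := by exact_mod_cast h2
      have h6 := mul_le_mul_of_nonneg_left h3 (show (0 : ℤ) ≤ Q by omega)
      have h7 := mul_le_mul_of_nonneg_right hRlt hPQpos.le
      have h8 : (2 : ℤ) * P ≤ Q * P := mul_le_mul_of_nonneg_right hQ2 (by omega)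
      linarith

theorem nt_main (e P Q S : ℕ) (he : e = 1 ∨ e = 2) (hQ : 2 ≤ Q) (hS : 3 ≤ S) (hSo : S % 2 = 1)
    (hPQ : Q < P) (hPS : S < P) (c1 : Nat.Coprime P Q) (c2 : Nat.Coprime P S) (c3 : Nat.Coprime Q S)
    (hev : e = 2 → P * Q % 2 = 0) : NTConc e P Q S := by
  by_cases hP : P < 57
  · exact nt_small e P Q S he hQ hS hSo hPQ hPS c1 c2 c3 hev hP
  · exact nt_big e P Q S he hQ hS hSo hPQ hPS c1 c2 c3 (by omega)

end NumberTheory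

section Converse

theorem trans_of {C D : Set G} (σ : MulAut G) (hD : ⇑σ '' C = D) (d : G)
    (h : ∀ c ∈ D, ∃ τ ∈ autSub D, τ d = c) : TransSet C := by
  left
  intro c hc c' hc'
  obtain ⟨τ, ht, htc⟩ := h (σ c) (hD ▸ Set.mem_image_of_mem _ hc)
  obtain ⟨τ', ht', htc'⟩ := h (σ c') (hD ▸ Set.mem_image_of_mem _ hc')
  have hρ : τ' * τ⁻¹ ∈ autSub D := mul_mem ht' (inv_mem ht)
  have hρ' : ⇑(τ' * τ⁻¹) '' D = D := hρ
  refine ⟨σ⁻¹ * (τ' * τ⁻¹) * σ, ?_, ?_⟩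
  · change ⇑(σ⁻¹ * (τ' * τ⁻¹) * σ) '' C = C
    have : ⇑(σ⁻¹ * (τ' * τ⁻¹) * σ) = ⇑σ⁻¹ ∘ ⇑(τ' * τ⁻¹) ∘ ⇑σ := rfl
    rw [this, Set.image_comp, Set.image_comp, hD, hρ', ← hD, ← Set.image_comp]
    have h2 : ⇑σ⁻¹ ∘ ⇑σ = id := by funext x; simp
    rw [h2, Set.image_id]
  · simp only [MulAut.mul_apply]
    rw [← htc, MulAut.inv_apply_self, htc', MulAut.inv_apply_self]

theorem dihAut_sr (n : ℕ) (u : (ZMod n)ˣ) (v a : ZMod n) :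
    dihAut n u v (.sr a) = .sr (u * a + v) := rfl

theorem dihAut_image (n : ℕ) (u : (ZMod n)ˣ) (v a b c d a' b' c' d' : ZMod n)
    (ha : u * a + v = a') (hb : u * b + v = b') (hc : u * c + v = c') (hd : u * d + v = d') :
    ⇑(dihAut n u v) '' {DihedralGroup.sr a, .sr b, .sr c, .sr d} =
      {DihedralGroup.sr a', .sr b', .sr c', .sr d'} := by
  simp only [Set.image_insert_eq, Set.image_singleton, dihAut_sr, ha, hb, hc, hd]

/-- transitivity via two commuting swaps -/
theorem trans_V4 {n : ℕ} {C : Set (DihedralGroup n)} (σ : MulAut (DihedralGroup n))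
    (i j k : ZMod n) (l m : (ZMod n)ˣ)
    (hD : ⇑σ '' C = {DihedralGroup.sr 0, .sr i, .sr j, .sr k})
    (l1 : l * i + i = 0) (l2 : l * j + i = k) (l3 : l * k + i = j)
    (m1 : m * j + j = 0) (m2 : m * i + j = k) (m3 : m * k + j = i) : TransSet C := by
  have hL : dihAut n l i ∈ autSub ({DihedralGroup.sr 0, .sr i, .sr j, .sr k} :
      Set (DihedralGroup n)) := by
    change _ '' _ = _
    rw [dihAut_image n l i 0 i j k i 0 k j (by simp) l1 l2 l3]
    ext x; simp only [Set.mem_insert_iff, Set.mem_singleton_iff]; tauto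
  have hM : dihAut n m j ∈ autSub ({DihedralGroup.sr 0, .sr i, .sr j, .sr k} :
      Set (DihedralGroup n)) := by
    change _ '' _ = _
    rw [dihAut_image n m j 0 i j k j k 0 i (by simp) m2 m1 m3]
    ext x; simp only [Set.mem_insert_iff, Set.mem_singleton_iff]; tauto
  refine trans_of σ hD (.sr 0) ?_
  rintro c (rfl | rfl | rfl | rfl)
  · exact ⟨1, one_mem _, rfl⟩
  · exact ⟨_, hL, by rw [dihAut_sr]; simp⟩
  · exact ⟨_, hM, by rw [dihAut_sr]; simp⟩
  · exact ⟨_, mul_mem hM hL, by rw [MulAut.mul_apply, dihAut_sr, dihAut_sr]; simp [m2]⟩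

theorem trans_a {n : ℕ} {C : Set (DihedralGroup n)} (σ : MulAut (DihedralGroup n))
    (i : ℕ) (h2 : 2 ≤ i) (hg : Nat.gcd (2 * i - 1) n = 1) (hd : n ∣ 2 * i * (i - 1))
    (hD : ⇑σ '' C = {DihedralGroup.sr 0, DihedralGroup.sr 1, DihedralGroup.sr (i : ZMod n),
          DihedralGroup.sr (1 - (i : ZMod n))}) : TransSet C := by
  have e1 : (2 * i * (i - 1) : ZMod n) = 0 := by
    have := (ZMod.natCast_eq_zero_iff (2 * i * (i - 1)) n).2 hd
    push_cast [Nat.cast_sub (show 1 ≤ i by omega)] at this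
    exact this
  have hu : ((-(ZMod.unitOfCoprime (2 * i - 1) hg) : (ZMod n)ˣ) : ZMod n) = 1 - 2 * i := by
    rw [Units.val_neg, ZMod.coe_unitOfCoprime, Nat.cast_sub (by omega)]
    push_cast; ring
  refine trans_V4 σ 1 i (1 - i) (-1) (-(ZMod.unitOfCoprime (2 * i - 1) hg)) hD
    (by simp) (by simp; ring) (by simp) ?_ ?_ ?_ <;> rw [hu]
  · linear_combination -e1
  · ring
  · linear_combination e1

theorem trans_b {n : ℕ} {C : Set (DihedralGroup n)} (σ : MulAut (DihedralGroup n))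
    (k : ℕ) (hg : Nat.Coprime k n) (hd : n ∣ 1 + k + k ^ 2 + k ^ 3)
    (hD : ⇑σ '' C = {DihedralGroup.sr 0, DihedralGroup.sr 1,
          DihedralGroup.sr ((k + 1 : ℕ) : ZMod n),
          DihedralGroup.sr ((k ^ 2 + k + 1 : ℕ) : ZMod n)}) : TransSet C := by
  have e1 : (1 + k + k ^ 2 + k ^ 3 : ZMod n) = 0 := by
    have := (ZMod.natCast_eq_zero_iff (1 + k + k ^ 2 + k ^ 3) n).2 hd
    push_cast at this
    exact this
  push_cast at hD
  have hL : dihAut n (ZMod.unitOfCoprime k hg) 1 ∈ autSub ({DihedralGroup.sr 0,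
      .sr 1, .sr (k + 1), .sr (k ^ 2 + k + 1)} : Set (DihedralGroup n)) := by
    change _ '' _ = _
    rw [dihAut_image n (ZMod.unitOfCoprime k hg) 1 0 1 (k + 1) (k ^ 2 + k + 1)
      1 (k + 1) (k ^ 2 + k + 1) 0 (by simp) (by simp)
      (by rw [ZMod.coe_unitOfCoprime]; ring) (by rw [ZMod.coe_unitOfCoprime]; linear_combination e1)]
    ext x; simp only [Set.mem_insert_iff, Set.mem_singleton_iff]; tauto
  refine trans_of σ hD (.sr 0) ?_
  rintro c (rfl | rfl | rfl | rfl)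
  · exact ⟨1, one_mem _, rfl⟩
  · exact ⟨_, hL, by rw [dihAut_sr]; simp⟩
  · exact ⟨_, mul_mem hL hL, by rw [MulAut.mul_apply, dihAut_sr, dihAut_sr]; simp⟩
  · refine ⟨_, mul_mem hL (mul_mem hL hL), ?_⟩
    rw [MulAut.mul_apply, MulAut.mul_apply, dihAut_sr, dihAut_sr, dihAut_sr, ZMod.coe_unitOfCoprime]
    congr 1; ring

theorem trans_c {n : ℕ} {C : Set (DihedralGroup n)} (σ : MulAut (DihedralGroup n))
    (i j k l m : ZMod n) (hl : l ^ 2 = 1) (hm : m ^ 2 = 1)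
    (e1 : k = j * l + i) (e2 : k = i * m + j) (e3 : i * (l + 1) = 0) (e4 : j * (m + 1) = 0)
    (hD : ⇑σ '' C = {DihedralGroup.sr 0, .sr i, .sr j, .sr k}) : TransSet C := by
  refine trans_V4 σ i j k ⟨l, l, by rw [← sq, hl], by rw [← sq, hl]⟩
    ⟨m, m, by rw [← sq, hm], by rw [← sq, hm]⟩ hD ?_ ?_ ?_ ?_ ?_ ?_
  · linear_combination e3
  · linear_combination -e1
  · linear_combination l * e1 + j * hl + e3
  · linear_combination e4
  · linear_combination -e2
  · linear_combination m * e2 + i * hm + e4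

end Converse
section Comb

def ff (a b c d : Fin 4) : Fin 4 → Fin 4 := fun i =>
  match i with
  | 0 => a
  | 1 => b
  | 2 => c
  | 3 => d

theorem ff_eta (f : Fin 4 → Fin 4) : ff (f 0) (f 1) (f 2) (f 3) = f := by
  funext i; fin_cases i <;> rfl

def wds (f g h : Fin 4 → Fin 4) : List (Fin 4 → Fin 4) :=
  let L := [f, g, h]
  let L2 := L.flatMap (fun x => L.map (fun y => fun i => x (y i)))
  L ++ (L2 ++ L.flatMap (fun x => L2.map (fun y => fun i => x (y i))))

def nd (a b c d : Fin 4) : Bool :=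
  a != b && a != c && a != d && b != c && b != d && c != d

def fourc (w : Fin 4 → Fin 4) : Bool := nd 0 (w 0) (w (w 0)) (w (w (w 0))) && w (w (w (w 0))) == 0

def isq (a b c d : Fin 4) (w : Fin 4 → Fin 4) : Bool := w 0 == a && w 1 == b && w 2 == c && w 3 == d

theorem comb_dec : ∀ b c d : Fin 4, nd 1 b c d = true → ∀ b' c' d' : Fin 4, nd 2 b' c' d' = true →
    ∀ b'' c'' d'' : Fin 4, nd 3 b'' c'' d'' = true →
    ((wds (ff 1 b c d) (ff 2 b' c' d') (ff 3 b'' c'' d'')).any fourc ||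
      ((wds (ff 1 b c d) (ff 2 b' c' d') (ff 3 b'' c'' d'')).any (isq 1 0 3 2) &&
       (wds (ff 1 b c d) (ff 2 b' c' d') (ff 3 b'' c'' d'')).any (isq 2 3 0 1))) = true := by
  decide +kernel

theorem comb (H : (Fin 4 → Fin 4) → Prop) (hc : ∀ f g, H f → H g → H (fun i => f (g i)))
    (hs : ∀ a, ∃ f, Function.Injective f ∧ f 0 = a ∧ H f) :
    (∃ f, H f ∧ fourc f = true) ∨ (H (ff 1 0 3 2) ∧ H (ff 2 3 0 1)) := by
  obtain ⟨f, hf, f0, Hf⟩ := hs 1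
  obtain ⟨g, hg, g0, Hg⟩ := hs 2
  obtain ⟨h, hh, h0, Hh⟩ := hs 3
  have key : ∀ f : Fin 4 → Fin 4, Function.Injective f → nd (f 0) (f 1) (f 2) (f 3) = true := by
    intro f hf
    simp [nd, hf.eq_iff]
  have k1 := key f hf
  have k2 := key g hg
  have k3 := key h hh
  rw [f0] at k1
  rw [g0] at k2
  rw [h0] at k3
  have := comb_dec _ _ _ k1 _ _ _ k2 _ _ _ k3
  have e1 : ff 1 (f 1) (f 2) (f 3) = f := by
    have := ff_eta f; rwa [f0] at this
  have e2 : ff 2 (g 1) (g 2) (g 3) = g := by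
    have := ff_eta g; rwa [g0] at this
  have e3 : ff 3 (h 1) (h 2) (h 3) = h := by
    have := ff_eta h; rwa [h0] at this
  rw [e1, e2, e3] at this
  have hw : ∀ w ∈ wds f g h, H w := by
    intro w hw
    simp only [wds, List.mem_append, List.mem_flatMap, List.mem_map] at hw
    have hL : ∀ x ∈ [f, g, h], H x := by simp [Hf, Hg, Hh]
    rcases hw with h | ⟨x, hx, y, hy, rfl⟩ | ⟨x, hx, y, ⟨z, hz, t, ht, rfl⟩, rfl⟩
    · exact hL _ h
    · exact hc _ _ (hL _ hx) (hL _ hy)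
    · exact hc _ _ (hL _ hx) (hc _ _ (hL _ hz) (hL _ ht))
  have hq : ∀ a b c d w, isq a b c d w = true → w = ff a b c d := by
    intro a b c d w hw
    simp only [isq, Bool.and_eq_true, beq_iff_eq] at hw
    rw [← ff_eta w, hw.1.1.1, hw.1.1.2, hw.1.2, hw.2]
  simp only [Bool.or_eq_true, Bool.and_eq_true, List.any_eq_true] at this
  rcases this with ⟨w, hm, hw'⟩ | ⟨⟨w, hm, hw'⟩, ⟨w2, hm2, hw2⟩⟩
  · exact Or.inl ⟨w, hw w hm, hw'⟩
  · exact Or.inr ⟨hq _ _ _ _ _ hw' ▸ hw w hm, hq _ _ _ _ _ hw2 ▸ hw w2 hm2⟩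

end Comb
section Structure

theorem aut_form (n : ℕ) (hn : 3 ≤ n) (σ : MulAut (DihedralGroup n)) :
    ∃ u v : ZMod n, (∀ x, σ (.r x) = .r (u * x)) ∧ (∀ x, σ (.sr x) = .sr (u * x + v)) := by
  haveI : NeZero n := ⟨by omega⟩
  have h1 : ∃ u, σ (.r 1) = .r u := by
    rcases h : σ (.r 1) with u | a
    · exact ⟨u, rfl⟩
    · exfalso
      have h2 : σ (.r 1 * .r 1) = 1 := by
        rw [map_mul, h, DihedralGroup.sr_mul_self]
      rw [← map_one σ] at h2
      have h3 := σ.injective h2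
      rw [DihedralGroup.r_mul_r, DihedralGroup.one_def] at h3
      have h4 : ((2 : ℕ) : ZMod n) = 0 := by
        have := DihedralGroup.r.inj h3
        rw [← this]; norm_num
      rw [ZMod.natCast_eq_zero_iff] at h4
      have := Nat.le_of_dvd (by norm_num) h4
      omega
  obtain ⟨u, hu⟩ := h1
  have hr : ∀ x, σ (.r x) = .r (u * x) := by
    intro x
    have : (DihedralGroup.r x : DihedralGroup n) = (DihedralGroup.r 1) ^ x.val := by
      rw [DihedralGroup.r_one_pow]; simp
    rw [this, map_pow, hu, DihedralGroup.r_pow]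
    simp
  have h2 : ∃ v, σ (.sr 0) = .sr v := by
    rcases h : σ (.sr 0) with w | v
    · exfalso
      obtain ⟨y, hy⟩ := σ.surjective (.sr 0)
      rcases y with y | y
      · rw [hr] at hy; cases hy
      · have : (DihedralGroup.sr y : DihedralGroup n) = .sr 0 * .r y := by simp
        rw [this, map_mul, h, hr, DihedralGroup.r_mul_r] at hy
        cases hy
    · exact ⟨v, rfl⟩
  obtain ⟨v, hv⟩ := h2
  refine ⟨u, v, hr, fun x => ?_⟩
  have : (DihedralGroup.sr x : DihedralGroup n) = .sr 0 * .r x := by simp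
  rw [this, map_mul, hv, hr, DihedralGroup.sr_mul_r, add_comm]

theorem exists_refl {n : ℕ} {C : Set (DihedralGroup n)} (hgen : Subgroup.closure C = ⊤) :
    ∃ y, DihedralGroup.sr y ∈ C := by
  by_contra! h
  have : Subgroup.closure C ≤ Subgroup.zpowers (DihedralGroup.r (1 : ZMod n)) := by
    rw [Subgroup.closure_le]
    rintro (x | x) hx
    · obtain ⟨z, rfl⟩ := ZMod.intCast_surjective x
      exact ⟨z, by simp [DihedralGroup.r_one_zpow]⟩
    · exact absurd hx (h x)
  rw [hgen] at this
  obtain ⟨z, hz⟩ := this (Subgroup.mem_top (DihedralGroup.sr (0 : ZMod n)))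
  simp [DihedralGroup.r_one_zpow] at hz

theorem trans_refl {n : ℕ} (hn : 3 ≤ n) {C : Set (DihedralGroup n)}
    (hgen : Subgroup.closure C = ⊤) (hT : TransSet C) :
    (∀ c ∈ C, ∃ x, c = DihedralGroup.sr x) ∧
      (∀ c ∈ C, ∀ c' ∈ C, ∃ σ ∈ autSub C, σ c = c') := by
  obtain ⟨y, hy⟩ := exists_refl hgen
  have hsr : ∀ (σ : MulAut (DihedralGroup n)) x, ∃ z, σ (.sr x) = .sr z := by
    intro σ x
    obtain ⟨u, v, _, h⟩ := aut_form n hn σ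
    exact ⟨_, h x⟩
  rcases hT with hT | ⟨cp, hcp, cm, hcm, hne, hU, hI⟩
  · refine ⟨fun c hc => ?_, hT⟩
    obtain ⟨σ, _, rfl⟩ := hT _ hy c hc
    exact hsr σ y
  · exfalso
    have hyo : DihedralGroup.sr y ∈ orbitC C cp := by
      rw [hU, hI] at hy
      rcases hy with h | h
      · exact h
      · simpa using h
    obtain ⟨σ, hσ, hs⟩ := hyo
    have hcp' : ∃ z, cp = .sr z := by
      obtain ⟨z, hz⟩ := hsr σ⁻¹ y
      exact ⟨z, by rw [← hz, ← hs, MulAut.inv_apply_self]⟩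
    obtain ⟨z, rfl⟩ := hcp'
    apply hne
    rw [hI]
    ext g
    rw [Set.mem_inv]
    constructor
    · rintro ⟨τ, hτ, rfl⟩
      obtain ⟨w, hw⟩ := hsr τ z
      exact ⟨τ, hτ, by rw [hw]; rfl⟩
    · rintro ⟨τ, hτ, h⟩
      obtain ⟨w, hw⟩ := hsr τ z
      refine ⟨τ, hτ, ?_⟩
      rw [hw] at h ⊢
      rw [← inv_inv g, ← h]; rfl

/-- generation: an additive subgroup containing all differences contains `1` -/
theorem gen_one {n : ℕ} {C : Set (DihedralGroup n)} (hgen : Subgroup.closure C = ⊤)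
    (x0 : ZMod n) (I : Ideal (ZMod n)) (h : ∀ c ∈ C, ∃ x, c = DihedralGroup.sr x ∧ x - x0 ∈ I) :
    (1 : ZMod n) ∈ I := by
  let K : Subgroup (DihedralGroup n) :=
    { carrier := {g | (∃ x ∈ I, g = .r x) ∨ (∃ x, x - x0 ∈ I ∧ g = .sr x)}
      one_mem' := Or.inl ⟨0, I.zero_mem, rfl⟩
      mul_mem' := by
        rintro a b (⟨x, hx, rfl⟩ | ⟨x, hx, rfl⟩) (⟨y, hy, rfl⟩ | ⟨y, hy, rfl⟩)
        · exact Or.inl ⟨x + y, I.add_mem hx hy, rfl⟩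
        · refine Or.inr ⟨y - x, ?_, by simp⟩
          have := I.sub_mem hy hx
          rwa [show y - x - x0 = y - x0 - x by ring]
        · refine Or.inr ⟨x + y, ?_, by simp⟩
          have := I.add_mem hx hy
          rwa [show x + y - x0 = x - x0 + y by ring]
        · refine Or.inl ⟨y - x, ?_, by simp⟩
          have := I.sub_mem hy hx
          rwa [show y - x = y - x0 - (x - x0) by ring]
      inv_mem' := by
        rintro a (⟨x, hx, rfl⟩ | ⟨x, hx, rfl⟩)
        · exact Or.inl ⟨-x, I.neg_mem hx, by simp⟩
        · exact Or.inr ⟨x, hx, by simp⟩ }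
  have hK : Subgroup.closure C ≤ K := by
    rw [Subgroup.closure_le]
    intro c hc
    obtain ⟨x, rfl, hx⟩ := h c hc
    exact Or.inr ⟨x, hx, rfl⟩
  rw [hgen] at hK
  rcases hK (Subgroup.mem_top (DihedralGroup.r (1 : ZMod n))) with ⟨x, hx, h⟩ | ⟨x, hx, h⟩
  · rw [DihedralGroup.r.inj h]; exact hx
  · cases h

theorem enum {n : ℕ} (hn : 3 ≤ n) {C : Set (DihedralGroup n)}
    (hgen : Subgroup.closure C = ⊤) (hcard : C.ncard = 4) (hT : TransSet C) :
    ∃ x : Fin 4 → ZMod n, Function.Injective x ∧ C = Set.range (fun a => DihedralGroup.sr (x a)) ∧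
      ∀ a, ∃ f : Fin 4 → Fin 4, Function.Injective f ∧ f 0 = a ∧
        ∃ u v : ZMod n, ∀ b, u * x b + v = x (f b) := by
  obtain ⟨hr, ht⟩ := trans_refl hn hgen hT
  haveI : Finite C := Set.finite_of_ncard_pos (by omega)
  let e : C ≃ Fin 4 := Finite.equivFinOfCardEq hcard
  choose x hx using fun a => hr _ (e.symm a).2
  have hC : C = Set.range (fun a => DihedralGroup.sr (x a)) := by
    ext c
    constructor
    · intro hc
      exact ⟨e ⟨c, hc⟩, by simp only [← hx]; simp⟩
    · rintro ⟨a, rfl⟩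
      simp only [← hx]
      exact (e.symm a).2
  have hinj : Function.Injective x := by
    intro a b hab
    apply e.symm.injective
    apply Subtype.ext
    rw [hx, hx, hab]
  refine ⟨x, hinj, hC, fun a => ?_⟩
  obtain ⟨σ, hσ, hs⟩ := ht _ (e.symm 0).2 _ (e.symm a).2
  have hσ' : ⇑σ '' C = C := hσ
  obtain ⟨u, v, _, huv⟩ := aut_form n hn σ
  have : ∀ b, ∃ c, u * x b + v = x c := by
    intro b
    have h1 : σ (.sr (x b)) ∈ C := by
      rw [← hσ']
      exact Set.mem_image_of_mem _ (by rw [hC]; exact ⟨b, rfl⟩)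
    rw [huv, hC] at h1
    obtain ⟨c, hc⟩ := h1
    exact ⟨c, (DihedralGroup.sr.inj hc).symm⟩
  choose f hf using this
  refine ⟨f, ?_, ?_, u, v, hf⟩
  · intro b c hbc
    apply hinj
    have : σ (.sr (x b)) = σ (.sr (x c)) := by rw [huv, huv, hf, hf, hbc]
    exact DihedralGroup.sr.inj (σ.injective this)
  · apply hinj
    rw [← hf]
    rw [hx, hx, huv] at hs
    exact DihedralGroup.sr.inj hs

end Structure
section Forward

/-- membership of a set in one of the families (a), (b), (c) -/
def Fam (n : ℕ) (D : Set (DihedralGroup n)) : Prop :=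
  (∃ i : ℕ, 2 ≤ i ∧ i ≤ n - 1 ∧ Nat.gcd (2 * i - 1) n = 1 ∧ n ∣ 2 * i * (i - 1) ∧
        D = {DihedralGroup.sr 0, DihedralGroup.sr 1, DihedralGroup.sr (i : ZMod n),
          DihedralGroup.sr (1 - (i : ZMod n))}) ∨
      (∃ k : ℕ, 1 ≤ k ∧ k ≤ n - 2 ∧ Nat.Coprime k n ∧ n ∣ 1 + k + k ^ 2 + k ^ 3 ∧
        D = {DihedralGroup.sr 0, DihedralGroup.sr 1,
          DihedralGroup.sr ((k + 1 : ℕ) : ZMod n),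
          DihedralGroup.sr ((k ^ 2 + k + 1 : ℕ) : ZMod n)}) ∨
      (5 ≤ n ∧ ∃ i j k : ℕ, 1 < i ∧ i < n ∧ 1 < j ∧ j < n ∧ 1 < k ∧ k < n ∧
        Nat.Coprime i j ∧ Nat.Coprime i k ∧ Nat.Coprime j k ∧
        1 < Nat.gcd i n ∧ 1 < Nat.gcd j n ∧ 1 < Nat.gcd k n ∧
        (∃ l m : ℤ, (l : ZMod n) ^ 2 = 1 ∧ (m : ZMod n) ^ 2 = 1 ∧
          (l : ZMod n) ≠ 1 ∧ (m : ZMod n) ≠ 1 ∧ (l : ZMod n) * (m : ZMod n) ≠ 1 ∧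
          (k : ZMod n) = (j : ZMod n) * (l : ZMod n) + (i : ZMod n) ∧
          (k : ZMod n) = (i : ZMod n) * (m : ZMod n) + (j : ZMod n) ∧
          (i : ZMod n) * ((l : ZMod n) + 1) = 0 ∧
          (j : ZMod n) * ((m : ZMod n) + 1) = 0) ∧
        D = {DihedralGroup.sr 0, DihedralGroup.sr (i : ZMod n),
          DihedralGroup.sr (j : ZMod n), DihedralGroup.sr (k : ZMod n)})

theorem case_b {n : ℕ} (hn : 3 ≤ n) {C : Set (DihedralGroup n)}
    (hgen : Subgroup.closure C = ⊤) (y0 y1 y2 y3 u v : ZMod n)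
    (hC : C = {DihedralGroup.sr y0, .sr y1, .sr y2, .sr y3})
    (h01 : y0 ≠ y1) (h02 : y0 ≠ y2) (h12 : y1 ≠ y2)
    (e0 : u * y0 + v = y1) (e1 : u * y1 + v = y2) (e2 : u * y2 + v = y3)
    (e3 : u * y3 + v = y0) : ∃ σ : MulAut (DihedralGroup n), Fam n (⇑σ '' C) := by
  have : NeZero n := ⟨by omega⟩
  have hd : (1 : ZMod n) ∈ Ideal.span {y1 - y0} := by
    apply gen_one hgen y0
    rw [hC]
    rintro c (rfl | rfl | rfl | rfl)
    · exact ⟨y0, rfl, by simp⟩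
    · exact ⟨y1, rfl, Ideal.mem_span_singleton'.2 ⟨1, by ring⟩⟩
    · exact ⟨y2, rfl, Ideal.mem_span_singleton'.2 ⟨1 + u, by linear_combination e1 - e0⟩⟩
    · exact ⟨y3, rfl, Ideal.mem_span_singleton'.2 ⟨1 + u + u ^ 2, by
        linear_combination u * (e1 - e0) + e2 - e0⟩⟩
  obtain ⟨w, hw⟩ := Ideal.mem_span_singleton'.1 hd
  let W : (ZMod n)ˣ := ⟨w, y1 - y0, hw, by rw [mul_comm]; exact hw⟩
  have hW : (W : ZMod n) = w := rfl
  have hs : 1 + u + u ^ 2 + u ^ 3 = 0 := by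
    linear_combination -(1 + u + u ^ 2 + u ^ 3) * hw +
      w * ((u ^ 2 + u) * (e1 - e0) + u * (e2 - e1) + e1 - e0 + e2 - e1 + e3 - e2)
  have hk : ((u.val : ℕ) : ZMod n) = u := ZMod.natCast_zmod_val u
  have hu0 : u ≠ 0 := by
    intro h; apply h12; rw [← e0, ← e1, h]; ring
  have hu1 : u ≠ -1 := by
    intro h; apply h02; rw [h] at e0 e1; linear_combination e1 - e0
  refine ⟨dihAut n W (-w * y0), Or.inr (Or.inl ⟨u.val, ?_, ?_, ?_, ?_, ?_⟩)⟩
  · rw [Nat.one_le_iff_ne_zero, Ne, ZMod.val_eq_zero]; exact hu0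
  · have h1 := ZMod.val_lt u
    have h2 : u.val ≠ n - 1 := by
      intro h
      apply hu1
      rw [← hk, h, Nat.cast_sub (by omega)]; simp
    omega
  · rw [← ZMod.isUnit_iff_coprime, hk]
    exact IsUnit.of_mul_eq_one (-(1 + u + u ^ 2)) (by linear_combination -hs)
  · rw [← ZMod.natCast_eq_zero_iff]
    push_cast
    rw [hk, hs]
  · rw [hC, dihAut_image n W (-w * y0) y0 y1 y2 y3 0 1 (u + 1) (u ^ 2 + u + 1)]
    · push_cast
      rw [hk]
    · rw [hW]; ring
    · rw [hW]; linear_combination hw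
    · rw [hW]; linear_combination w * (e0 - e1) + (1 + u) * hw
    · rw [hW]; linear_combination w * (e0 - e2) + w * u * (e0 - e1) + (u ^ 2 + u + 1) * hw

/-- two double transpositions -/
structure V4h (n : ℕ) (i j k l m : ZMod n) : Prop where
  l1 : l * i + i = 0
  l2 : l * j + i = k
  l3 : l * k + i = j
  m1 : m * j + j = 0
  m2 : m * i + j = k
  m3 : m * k + j = i
  g : ∃ α β, α * i + β * j = 1
  i0 : i ≠ 0
  j0 : j ≠ 0
  k0 : k ≠ 0
  ij : i ≠ j
  ik : i ≠ k
  jk : j ≠ k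

theorem V4h.swap {n : ℕ} {i j k l m : ZMod n} (h : V4h n i j k l m) : V4h n j i k m l := by
  obtain ⟨α, β, hg⟩ := h.g
  exact ⟨h.m1, h.m2, h.m3, h.l1, h.l2, h.l3, ⟨β, α, by rw [add_comm]; exact hg⟩, h.j0, h.i0, h.k0,
    h.ij.symm, h.jk, h.ik⟩

theorem V4h.swap' {n : ℕ} {i j k l m : ZMod n} (h : V4h n i j k l m) :
    V4h n k j i (l * m) m := by
  obtain ⟨α, β, hg⟩ := h.g
  obtain ⟨l1, l2, l3, m1, m2, m3, _, i0, j0, k0, ij, ik, jk⟩ := h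
  refine ⟨?_, ?_, ?_, m1, m3, m2, ⟨α * m, α + β, ?_⟩, k0, j0, i0, jk.symm, ik.symm, ij.symm⟩
  · linear_combination l * m3 - l2 + l1
  · linear_combination l * m1 - l2
  · linear_combination l * m2 + l3 - l2
  · linear_combination hg + α * m3

theorem V4h.lsq {n : ℕ} {i j k l m : ZMod n} (h : V4h n i j k l m) : l ^ 2 = 1 := by
  obtain ⟨α, β, hg⟩ := h.g
  obtain ⟨l1, l2, l3, m1, m2, m3, _, i0, j0, k0, ij, ik, jk⟩ := h
  linear_combination (1 - l ^ 2) * hg + α * (l * l1 - l1) + β * (l * l2 + l3 - l1)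

/-- conclusion for the normalized set -/
def Goal (n : ℕ) (i j k : ZMod n) : Prop :=
  ∃ σ : MulAut (DihedralGroup n), Fam n (⇑σ '' {DihedralGroup.sr 0, .sr i, .sr j, .sr k})

theorem Goal.swap {n : ℕ} {i j k : ZMod n} (h : Goal n i j k) : Goal n j i k := by
  unfold Goal at *
  rwa [Set.insert_comm (DihedralGroup.sr j)]

theorem Goal.swap' {n : ℕ} {i j k : ZMod n} (h : Goal n i j k) : Goal n k j i := by
  unfold Goal at *
  have : ({DihedralGroup.sr 0, .sr k, .sr j, .sr i} : Set (DihedralGroup n)) =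
      {DihedralGroup.sr 0, .sr i, .sr j, .sr k} := by
    ext x; simp only [Set.mem_insert_iff, Set.mem_singleton_iff]; tauto
  rwa [this]

theorem case_a {n : ℕ} (hn : 3 ≤ n) {i j k l m : ZMod n} (h : V4h n i j k l m) (hi : IsUnit i) :
    Goal n i j k := by
  have : NeZero n := ⟨by omega⟩
  have hm2 := h.swap.lsq
  obtain ⟨l1, l2, l3, m1, m2, m3, _, i0, j0, k0, ij, ik, jk⟩ := h
  obtain ⟨u, rfl⟩ := hi
  have hl : l = -1 := by
    have : (l + 1) * (u : ZMod n) = 0 := by linear_combination l1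
    rw [Units.mul_left_eq_zero] at this
    linear_combination this
  set w : ZMod n := ((u⁻¹ : (ZMod n)ˣ) : ZMod n) with hw
  have hwu : w * u = 1 := u.inv_mul
  set q := w * j with hq
  have hqv : ((q.val : ℕ) : ZMod n) = q := ZMod.natCast_zmod_val q
  have hm : m = 1 - 2 * q := by
    rw [hl] at l2
    linear_combination w * (m2 - l2) + (1 - m) * hwu
  have hq0 : q ≠ 0 := by
    intro h; apply j0
    linear_combination (u : ZMod n) * h - j * hwu
  have hq1 : q ≠ 1 := by
    intro h; apply ij
    linear_combination -(u : ZMod n) * h + j * hwu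
  have hv0 : q.val ≠ 0 := by rwa [Ne, ZMod.val_eq_zero]
  have hv1 : q.val ≠ 1 := by
    intro h; apply hq1; rw [← hqv, h]; simp
  have hc1 : ((2 * q.val - 1 : ℕ) : ZMod n) = 2 * q - 1 := by
    rw [Nat.cast_sub (by omega)]; push_cast; rw [hqv]
  refine ⟨dihAut n u⁻¹ 0, Or.inl ⟨q.val, by omega, ?_, ?_, ?_, ?_⟩⟩
  · have := ZMod.val_lt q
    omega
  · change Nat.Coprime _ _
    rw [← ZMod.isUnit_iff_coprime, hc1]
    exact IsUnit.of_mul_eq_one (2 * q - 1) (by rw [hm] at hm2; linear_combination hm2)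
  · rw [← ZMod.natCast_eq_zero_iff]
    rw [Nat.cast_mul, Nat.cast_sub (by omega)]
    push_cast
    rw [hqv]
    rw [hm] at m1
    linear_combination -w * m1
  · rw [dihAut_image n u⁻¹ 0 0 u j k 0 1 q (1 - q), hqv]
    · simp
    · simp
    · rw [← hw]; ring
    · rw [← hw]
      rw [hl] at l2
      linear_combination -w * l2 + hwu

end Forward
section CaseC

def gz {n : ℕ} (z : ZMod n) : ℕ := Nat.gcd z.val n

theorem gz_gt {n : ℕ} [NeZero n] {z : ZMod n} (hz : ¬ IsUnit z) : 1 < gz z := by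
  have h0 : 0 < gz z := Nat.gcd_pos_of_pos_right _ (NeZero.pos n)
  have h1 : gz z ≠ 1 := by
    intro h
    apply hz
    rw [← ZMod.natCast_zmod_val z, ZMod.isUnit_iff_coprime]
    exact h
  omega

theorem V4h.cop {n : ℕ} [NeZero n] {i j k l m : ZMod n} (h : V4h n i j k l m) :
    Nat.Coprime (gz i) (gz j) := by
  obtain ⟨α, β, hg⟩ := h.g
  have h1 : (n : ℤ) ∣ α.val * i.val + β.val * j.val - 1 := by
    rw [← ZMod.intCast_zmod_eq_zero_iff_dvd]
    push_cast
    simp only [ZMod.natCast_zmod_val]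
    rw [hg, sub_self]
  apply Nat.Coprime.symm
  rw [Nat.coprime_iff_gcd_eq_one]
  apply Nat.dvd_one.1
  have d1 : Nat.gcd (gz j) (gz i) ∣ i.val := (Nat.gcd_dvd_right _ _).trans (Nat.gcd_dvd_left _ _)
  have d2 : Nat.gcd (gz j) (gz i) ∣ j.val := (Nat.gcd_dvd_left _ _).trans (Nat.gcd_dvd_left _ _)
  have d3 : Nat.gcd (gz j) (gz i) ∣ n := (Nat.gcd_dvd_left _ _).trans (Nat.gcd_dvd_right _ _)
  generalize Nat.gcd (gz j) (gz i) = d at *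
  have d1' : (d : ℤ) ∣ i.val := by exact_mod_cast d1
  have d2' : (d : ℤ) ∣ j.val := by exact_mod_cast d2
  have d3' : (d : ℤ) ∣ α.val * i.val + β.val * j.val - 1 :=
    (Int.natCast_dvd_natCast.2 d3).trans h1
  have d4 : (d : ℤ) ∣ (α.val * i.val + β.val * j.val) -
    (α.val * i.val + β.val * j.val - 1) := dvd_sub (dvd_add (d1'.mul_left _) (d2'.mul_left _)) d3'
  have d5 : (d : ℤ) ∣ 1 := by simpa using d4
  exact_mod_cast d5

theorem gz_two {n : ℕ} [NeZero n] {z : ZMod n} (hz : 2 * z = 0) : n ∣ 2 * gz z := by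
  have h1 : n ∣ 2 * z.val := by
    rw [← ZMod.natCast_eq_zero_iff]; push_cast; rw [ZMod.natCast_zmod_val, hz]
  have h2 : n ∣ Nat.gcd n (2 * z.val) := Nat.dvd_gcd dvd_rfl h1
  refine h2.trans ((Nat.gcd_mul_right_dvd_mul_gcd n 2 z.val).trans ?_)
  rw [gz, Nat.gcd_comm z.val n]
  exact Nat.mul_dvd_mul_right (Nat.gcd_dvd_right _ _) _

theorem V4h.rel {n : ℕ} {i j k l m : ZMod n} (h : V4h n i j k l m) : i * (k + j - i) = 0 := by
  linear_combination j * h.l1 - i * h.l2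

theorem V4h.prod {n : ℕ} [NeZero n] {i j k l m : ZMod n} (h : V4h n i j k l m) :
    n ∣ 2 * (gz j * gz i * gz k) := by
  have h0 : 2 * (j * i * k) = 0 := by
    linear_combination k * h.rel + i * h.swap'.rel
  have h1 : n ∣ 2 * (j.val * i.val * k.val) := by
    rw [← ZMod.natCast_eq_zero_iff]; push_cast; simp only [ZMod.natCast_zmod_val]; exact h0
  have h2 : n ∣ Nat.gcd n (2 * (j.val * i.val * k.val)) := Nat.dvd_gcd dvd_rfl h1
  refine h2.trans ((Nat.gcd_mul_right_dvd_mul_gcd n 2 _).trans ?_)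
  apply Nat.mul_dvd_mul (Nat.gcd_dvd_right _ _)
  refine (Nat.gcd_mul_right_dvd_mul_gcd n _ _).trans ?_
  rw [gz, gz, gz, Nat.gcd_comm k.val n, Nat.gcd_comm j.val n, Nat.gcd_comm i.val n]
  exact Nat.mul_dvd_mul_right (Nat.gcd_mul_right_dvd_mul_gcd n _ _) _


theorem gz_quot {n M : ℕ} [NeZero n] {z : ZMod n} (hM : n = gz z * M) :
    ∃ x, z.val = gz z * x ∧ Nat.Coprime x M := by
  have h0 : 0 < gz z := Nat.gcd_pos_of_pos_right _ (NeZero.pos n)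
  obtain ⟨x, hx⟩ : gz z ∣ z.val := Nat.gcd_dvd_left _ _
  refine ⟨x, hx, ?_⟩
  have h1 : gz z = gz z * Nat.gcd x M := by
    rw [← Nat.gcd_mul_left, ← hx, ← hM]; rfl
  exact Nat.eq_of_mul_eq_mul_left h0 (by rw [← h1, mul_one])

theorem V4h.dvd {n M : ℕ} [NeZero n] {i j k l m : ZMod n} (h : V4h n i j k l m)
    (hM : n = gz i * M) : (M : ℤ) ∣ k.val + j.val - i.val := by
  have h0 : 0 < gz i := Nat.gcd_pos_of_pos_right _ (NeZero.pos n)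
  have h1 : (n : ℤ) ∣ i.val * (k.val + j.val - i.val) := by
    rw [← ZMod.intCast_zmod_eq_zero_iff_dvd]
    push_cast
    simp only [ZMod.natCast_zmod_val]
    exact h.rel
  obtain ⟨x, hx, hc⟩ := gz_quot hM
  have h2 : ((gz i : ℕ) : ℤ) * M ∣ (gz i : ℕ) * (x * (k.val + j.val - i.val)) := by
    have e1 : ((gz i : ℕ) : ℤ) * M = n := by exact_mod_cast hM.symm
    rw [e1, ← mul_assoc]
    have e2 : ((gz i : ℕ) : ℤ) * x = i.val := by exact_mod_cast hx.symm
    rw [e2]; exact h1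
  have h3 := Int.dvd_of_mul_dvd_mul_left (by exact_mod_cast h0.ne') h2
  exact (Nat.isCoprime_iff_coprime.2 hc).symm.dvd_of_dvd_mul_left h3

theorem core {n : ℕ} [NeZero n] {i j k l m : ZMod n} (h : V4h n i j k l m)
    (hi : ¬ IsUnit i) (hj : ¬ IsUnit j) (hk : ¬ IsUnit k)
    (hij : gz i < gz j) (hkj : gz k < gz j) (hodd : gz k % 2 = 1) : Goal n i j k := by
  have cQP : Nat.Coprime (gz i) (gz j) := h.cop
  have cSP : Nat.Coprime (gz k) (gz j) := h.swap'.cop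
  have cSQ : Nat.Coprime (gz k) (gz i) := h.swap.swap'.cop
  have hQ1 := gz_gt hi
  have hP1 := gz_gt hj
  have hS1 := gz_gt hk
  have hdvd : gz j * gz i * gz k ∣ n := by
    apply Nat.Coprime.mul_dvd_of_dvd_of_dvd
    · exact (Nat.Coprime.mul_right cSP cSQ).symm
    · exact Nat.Coprime.mul_dvd_of_dvd_of_dvd cQP.symm (Nat.gcd_dvd_right _ _)
        (Nat.gcd_dvd_right _ _)
    · exact Nat.gcd_dvd_right _ _
  have hprod := h.prod
  obtain ⟨e, hne⟩ := hdvd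
  have he : e = 1 ∨ e = 2 := by
    have hpos : 0 < gz j * gz i * gz k := by positivity
    have : e ∣ 2 := by
      apply Nat.dvd_of_mul_dvd_mul_left hpos
      rw [← hne, mul_comm _ 2]; exact hprod
    exact (Nat.dvd_prime Nat.prime_two).1 this
  have dI : ((e * gz j * gz k : ℕ) : ℤ) ∣ k.val + j.val - i.val := h.dvd (hne.trans (by ring))
  have dJ : ((e * gz i * gz k : ℕ) : ℤ) ∣ k.val + i.val - j.val := h.swap.dvd (hne.trans (by ring))
  have dK : ((e * gz j * gz i : ℕ) : ℤ) ∣ i.val + j.val - k.val := h.swap'.dvd (hne.trans (by ring))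
  obtain ⟨x, hx, cx⟩ := gz_quot (z := i) (M := e * gz j * gz k) (hne.trans (by ring))
  obtain ⟨y, hy, cy⟩ := gz_quot (z := j) (M := e * gz i * gz k) (hne.trans (by ring))
  obtain ⟨t, ht, ct⟩ := gz_quot (z := k) (M := e * gz j * gz i) (hne.trans (by ring))
  have ti : 2 * i = 0 → n ∣ 2 * gz i := gz_two
  have tj : 2 * j = 0 → n ∣ 2 * gz j := gz_two
  have tk : 2 * k = 0 → n ∣ 2 * gz k := gz_two
  generalize gz j = P at *
  generalize gz i = Q at *
  generalize gz k = S at *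
  have hS3 : 3 ≤ S := by omega
  have odd_of : ∀ z a b, Nat.Coprime z (e * a * b) → e = 2 → z % 2 = 1 := by
    intro z a b hc h2
    have : Nat.Coprime z 2 := by
      rw [mul_assoc] at hc; rw [← h2]; exact hc.coprime_mul_right_right
    exact Nat.odd_iff.1 (Nat.coprime_two_right.1 this)
  have hev : e = 2 → P * Q % 2 = 0 := by
    intro h2
    have ox := odd_of _ _ _ cx h2
    have oy := odd_of _ _ _ cy h2
    have ot := odd_of _ _ _ ct h2
    by_contra hcon
    have hPo : P % 2 = 1 := by
      rcases Nat.mod_two_eq_zero_or_one P with h | h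
      · exact absurd (by rw [Nat.mul_mod, h]; simp) hcon
      · exact h
    have hQo : Q % 2 = 1 := by
      rcases Nat.mod_two_eq_zero_or_one Q with h | h
      · exact absurd (by rw [Nat.mul_mod, h]; simp) hcon
      · exact h
    have o1 : i.val % 2 = 1 := by rw [hx, Nat.mul_mod, hQo, ox]
    have o2 : j.val % 2 = 1 := by rw [hy, Nat.mul_mod, hPo, oy]
    have o3 : k.val % 2 = 1 := by rw [ht, Nat.mul_mod, hodd, ot]
    have : (2 : ℤ) ∣ i.val + j.val - k.val := by
      refine Dvd.dvd.trans ?_ dK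
      rw [h2]; exact ⟨P * Q, by push_cast; ring⟩
    omega
  obtain ⟨X, k', hX0, hXn, hk0, hkn, hXm, hSk, hdk, hXo, cXP, cXk⟩ :=
    nt_main e P Q S he (by omega) hS3 hodd hij hkj cQP.symm cSP.symm cSQ.symm hev
  have hn' : n = e * P * Q * S := by rw [hne]; ring
  have hbig : 6 * Q < n ∧ 6 * P ≤ n ∧ 6 * S < n := by
    have e1 : 1 ≤ e := by omega
    have q1 : Q * (1 * (3 * 3)) ≤ Q * (e * (P * S)) :=
      Nat.mul_le_mul_left _ (Nat.mul_le_mul e1 (Nat.mul_le_mul (by omega) hS3))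
    have q2 : P * (1 * (2 * 3)) ≤ P * (e * (Q * S)) :=
      Nat.mul_le_mul_left _ (Nat.mul_le_mul e1 (Nat.mul_le_mul (by omega) hS3))
    rw [hn', show e * P * Q * S = Q * (e * (P * S)) by ring]
    refine ⟨by omega, ?_, ?_⟩
    · rw [show Q * (e * (P * S)) = P * (e * (Q * S)) by ring]; omega
    · rw [show Q * (e * (P * S)) = P * (e * (Q * S)) by ring]; omega
  have hne1 : ∀ A, 6 * A ≤ n → 1 < A → ¬ n ∣ 2 * A := by
    intro A h1 h2 h3
    have := Nat.le_of_dvd (by omega) h3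
    omega
  -- the cross relation
  have hcross : i * (P : ZMod n) = ((Q * X : ℕ) : ZMod n) * j := by
    have s1 : (S : ℤ) ∣ P - Q * X := by
      have := (Nat.modEq_iff_dvd).1 hXm
      exact_mod_cast this
    have s2 : (S : ℤ) ∣ i.val - j.val := by
      have a1 : (S : ℤ) ∣ k.val + i.val - j.val :=
        Dvd.dvd.trans ⟨e * Q, by push_cast; ring⟩ dJ
      have a2 : (S : ℤ) ∣ k.val := ⟨t, by exact_mod_cast ht⟩
      have := dvd_sub a1 a2
      rwa [show (k.val + i.val - j.val - k.val : ℤ) = i.val - j.val by ring] at this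
    have hxz : (i.val : ℤ) = Q * x := by exact_mod_cast hx
    have hyz : (j.val : ℤ) = P * y := by exact_mod_cast hy
    have s3 : (S : ℤ) ∣ (P * Q : ℕ) * (x - X * y) := by
      have : ((P * Q : ℕ) * (x - X * y) : ℤ) =
          i.val * (P - Q * X) + Q * X * (i.val - j.val) := by
        rw [hxz, hyz]; push_cast; ring
      rw [this]
      exact dvd_add (s1.mul_left _) (s2.mul_left _)
    have s4 : (S : ℤ) ∣ x - X * y :=
      (Nat.isCoprime_iff_coprime.2 (Nat.Coprime.mul_right cSP cSQ)).dvd_of_dvd_mul_left s3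
    have s5 : ((e * S : ℕ) : ℤ) ∣ x - X * y := by
      rcases he with he | he
      · rw [he, one_mul]; exact s4
      · have ox := odd_of _ _ _ cx he
        have oy := odd_of _ _ _ cy he
        have oX := hXo he
        have o1 : (X * y) % 2 = 1 := by rw [Nat.mul_mod, oX, oy]
        have s6 : ((2 : ℕ) : ℤ) ∣ x - X * y := by
          have : ((X * y : ℕ) : ℤ) = X * y := by push_cast; ring
          rw [← this]; omega
        rw [he]; push_cast
        apply IsCoprime.mul_dvd _ s6 s4
        have : Nat.Coprime 2 S := Nat.coprime_two_left.2 (Nat.odd_iff.2 hodd)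
        exact Nat.isCoprime_iff_coprime.2 this
    have s7 : (n : ℤ) ∣ i.val * P - (Q * X : ℕ) * j.val := by
      obtain ⟨c, hc⟩ := s5
      refine ⟨c, ?_⟩
      rw [hxz, hyz, hn']
      push_cast at hc ⊢
      linear_combination (P * Q : ℤ) * hc
    rw [← ZMod.intCast_zmod_eq_zero_iff_dvd] at s7
    push_cast at s7
    simp only [ZMod.natCast_zmod_val] at s7
    push_cast
    linear_combination s7
  have cQXP : Nat.Coprime (Q * X) P := Nat.Coprime.mul_left cQP cXP
  have hdk' : ∀ d : ℕ, d ∣ P * Q → (d : ℤ) ∣ (Q * X + P - k' : ℤ) := by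
    intro d hd
    refine Dvd.dvd.trans ?_ hdk
    rw [mul_assoc]
    exact_mod_cast hd.mul_left e
  have cPk : Nat.Coprime P k' := by
    apply Nat.coprime_of_dvd
    intro p hp d1 d2
    have a1 := hdk' p (d1.mul_right _)
    have a2 : (p : ℤ) ∣ (P : ℤ) := by exact_mod_cast d1
    have a3 : (p : ℤ) ∣ (k' : ℤ) := by exact_mod_cast d2
    have a4 : (p : ℤ) ∣ (Q * X : ℕ) := by
      have := dvd_add (dvd_sub a1 a2) a3
      push_cast
      rwa [show (Q * X + P - k' - P + k' : ℤ) = Q * X by ring] at this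
    exact hp.one_lt.ne' (Nat.dvd_one.1 (cQXP ▸ Nat.dvd_gcd (by exact_mod_cast a4) d1))
  have cQk : Nat.Coprime Q k' := by
    apply Nat.coprime_of_dvd
    intro p hp d1 d2
    have a1 := hdk' p (d1.mul_left _)
    have a2 : (p : ℤ) ∣ (Q : ℤ) := by exact_mod_cast d1
    have a3 : (p : ℤ) ∣ (k' : ℤ) := by exact_mod_cast d2
    have a4 : (p : ℤ) ∣ (P : ℤ) := by
      have := dvd_add (dvd_sub a1 (a2.mul_right X)) a3
      rwa [show (Q * X + P - k' - Q * X + k' : ℤ) = P by ring] at this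
    exact hp.one_lt.ne' (Nat.dvd_one.1 (cQP ▸ Nat.dvd_gcd d1 (by exact_mod_cast a4)))
  have bez : ∀ a b : ℕ, Nat.Coprime a b → ∃ α β : ZMod n, α * a + β * b = 1 := by
    intro a b hab
    have := Nat.gcd_eq_gcd_ab a b
    rw [show Nat.gcd a b = 1 from hab] at this
    refine ⟨(Nat.gcdA a b : ℤ), (Nat.gcdB a b : ℤ), ?_⟩
    have h2 := congrArg (fun z : ℤ => (z : ZMod n)) this
    push_cast at h2
    rw [h2]; ring
  obtain ⟨α, β, hg⟩ := h.g
  obtain ⟨α', β', hg'⟩ := bez _ _ cQXP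
  set I' : ZMod n := ((Q * X : ℕ) : ZMod n) with hI'
  set J' : ZMod n := (P : ZMod n) with hJ'
  set u : ZMod n := α * I' + β * J' with hu
  have ui : u * i = I' := by
    rw [hu]; linear_combination β * hcross + I' * hg
  have uj : u * j = J' := by
    rw [hu]; linear_combination -α * hcross + J' * hg
  have uu : u * (α' * i + β' * j) = 1 := by
    linear_combination α' * ui + β' * uj + hg'
  have uk : u * k = (k' : ZMod n) := by
    have cS : Nat.Coprime S (e * P * Q) := by
      apply Nat.Coprime.mul_right (Nat.Coprime.mul_right _ cSP) cSQ
      rcases he with he | he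
      · rw [he]; simp
      · rw [he]; exact Nat.coprime_two_right.2 (Nat.odd_iff.2 hodd)
    obtain ⟨a, b, hab⟩ := bez _ _ cS
    obtain ⟨c, hc⟩ := dK
    obtain ⟨c', hc'⟩ := hdk
    obtain ⟨t', ht'⟩ := hSk
    have z0 : ((e * P * Q : ℕ) : ZMod n) * S = 0 := by
      rw [← Nat.cast_mul, ← hn']; simp
    have z1 : i + j - k = ((e * P * Q : ℕ) : ZMod n) * c := by
      have := congrArg (fun z : ℤ => (z : ZMod n)) hc
      push_cast at this ⊢
      simpa only [ZMod.natCast_zmod_val] using this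
    have z2 : I' + J' - k' = ((e * P * Q : ℕ) : ZMod n) * c' := by
      have := congrArg (fun z : ℤ => (z : ZMod n)) hc'
      push_cast at this ⊢
      rw [hI', hJ']; push_cast
      exact this
    have z3 : k = S * t := by
      have := congrArg (fun z : ℕ => (z : ZMod n)) ht
      push_cast at this
      simpa only [ZMod.natCast_zmod_val] using this
    have z4 : (k' : ZMod n) = S * t' := by rw [ht']; push_cast; ring
    linear_combination (-(u * k - k')) * hab + a * S * (ui + uj - u * z1 + z2) +
      b * ((e * P * Q : ℕ) : ZMod n) * (u * z3 - z4) +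
      (-a * u * c + a * c' + b * u * t - b * t') * z0
  let U : (ZMod n)ˣ := ⟨u, α' * i + β' * j, uu, by rw [mul_comm]; exact uu⟩
  have hU : (U : ZMod n) = u := rfl
  obtain ⟨lz, hlz⟩ := ZMod.intCast_surjective l
  obtain ⟨mz, hmz⟩ := ZMod.intCast_surjective m
  have hlsq := h.lsq
  have hmsq := h.swap.lsq
  have hlm1 := h.swap'.l1
  obtain ⟨l1, l2, l3, m1, m2, m3, _⟩ := h
  have hQX : Q ≤ Q * X := Nat.le_mul_of_pos_right _ hX0
  have hSk' : S ≤ k' := Nat.le_of_dvd hk0 hSk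
  refine ⟨dihAut n U 0, Or.inr (Or.inr ⟨by omega, Q * X, P, k', by omega, by omega, by omega,
    by omega, by omega, by omega, cQXP, Nat.Coprime.mul_left cQk cXk, cPk, ?_, ?_, ?_,
    ⟨lz, mz, ?_⟩, ?_⟩)⟩
  · have : Q ∣ Nat.gcd (Q * X) n := Nat.dvd_gcd ⟨X, rfl⟩ ⟨e * P * S, by rw [hn']; ring⟩
    have := Nat.le_of_dvd (Nat.gcd_pos_of_pos_right _ (NeZero.pos n)) this
    omega
  · have : P ∣ Nat.gcd P n := Nat.dvd_gcd dvd_rfl ⟨e * Q * S, by rw [hn']; ring⟩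
    have := Nat.le_of_dvd (Nat.gcd_pos_of_pos_right _ (NeZero.pos n)) this
    omega
  · have : S ∣ Nat.gcd k' n := Nat.dvd_gcd hSk ⟨e * P * Q, by rw [hn']; ring⟩
    have := Nat.le_of_dvd (Nat.gcd_pos_of_pos_right _ (NeZero.pos n)) this
    omega
  · rw [hlz, hmz, ← uk]
    change _ ∧ _ ∧ _ ∧ _ ∧ _ ∧ u * k = J' * l + I' ∧ u * k = I' * m + J' ∧ I' * (l + 1) = 0 ∧
      J' * (m + 1) = 0
    rw [← ui, ← uj]
    refine ⟨hlsq, hmsq, ?_, ?_, ?_, ?_, ?_, ?_, ?_⟩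
    · intro h1
      exact hne1 Q (by omega) hQ1 (ti (by rw [h1] at l1; linear_combination l1))
    · intro h1
      exact hne1 P (by omega) hP1 (tj (by rw [h1] at m1; linear_combination m1))
    · intro h1
      exact hne1 S (by omega) hS1 (tk (by rw [h1] at hlm1; linear_combination hlm1))
    · linear_combination -u * l2
    · linear_combination -u * m2
    · linear_combination u * l1
    · linear_combination u * m1
  · rw [dihAut_image n U 0 0 i j k 0 I' J' k' (by simp) (by rw [hU, add_zero, ui])
      (by rw [hU, add_zero, uj]) (by rw [hU, add_zero, uk])]

theorem case_max {n : ℕ} [NeZero n] {i j k l m : ZMod n} (h : V4h n i j k l m)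
    (hi : ¬ IsUnit i) (hj : ¬ IsUnit j) (hk : ¬ IsUnit k)
    (hij : gz i < gz j) (hkj : gz k < gz j) : Goal n i j k := by
  rcases Nat.mod_two_eq_zero_or_one (gz k) with h0 | h1
  · refine (core h.swap' hk hj hi hkj hij ?_).swap'
    rcases Nat.mod_two_eq_zero_or_one (gz i) with h0' | h1
    · exfalso
      have c : Nat.Coprime (gz k) (gz i) := h.swap.swap'.cop
      have : 2 ∣ Nat.gcd (gz k) (gz i) :=
        Nat.dvd_gcd (Nat.dvd_of_mod_eq_zero h0) (Nat.dvd_of_mod_eq_zero h0')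
      rw [show Nat.gcd (gz k) (gz i) = 1 from c] at this
      omega
    · exact h1
  · exact core h hi hj hk hij hkj h1

theorem case_V4 {n : ℕ} (hn : 3 ≤ n) {i j k l m : ZMod n} (h : V4h n i j k l m) :
    Goal n i j k := by
  have : NeZero n := ⟨by omega⟩
  by_cases hi : IsUnit i
  · exact case_a hn h hi
  by_cases hj : IsUnit j
  · exact (case_a hn h.swap hj).swap
  by_cases hk : IsUnit k
  · exact (case_a hn h.swap' hk).swap'
  have ne : ∀ {i j : ZMod n}, Nat.Coprime (gz i) (gz j) → ¬ IsUnit i → gz i ≠ gz j := by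
    intro i j hc hi he
    rw [← he, Nat.coprime_self] at hc
    have := gz_gt hi
    omega
  have n1 := ne h.cop hi
  have n2 := ne h.swap'.cop hk
  have n3 := ne h.swap.swap'.cop hk
  rcases lt_or_gt_of_ne n1 with a | a
  · rcases lt_or_gt_of_ne n2 with b | b
    · exact case_max h hi hj hk a b
    · exact (case_max h.swap.swap'.swap hi hk hj (by omega) b).swap.swap'.swap
  · rcases lt_or_gt_of_ne n3 with b | b
    · exact (case_max h.swap hj hi hk a b).swap
    · exact (case_max h.swap.swap'.swap hi hk hj b (by omega)).swap.swap'.swap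

end CaseC
section Final

theorem range_four {n : ℕ} (x : Fin 4 → ZMod n) (a b c d : Fin 4) (h : nd a b c d = true) :
    Set.range (fun a => DihedralGroup.sr (x a)) =
      {DihedralGroup.sr (x a), .sr (x b), .sr (x c), .sr (x d)} := by
  have key : ∀ a b c d : Fin 4, nd a b c d = true → ∀ e, e = a ∨ e = b ∨ e = c ∨ e = d := by
    decide
  ext g
  simp only [Set.mem_range, Set.mem_insert_iff, Set.mem_singleton_iff]
  constructor
  · rintro ⟨e, rfl⟩
    rcases key a b c d h e with rfl | rfl | rfl | rfl <;> simp
  · rintro (rfl | rfl | rfl | rfl) <;> exact ⟨_, rfl⟩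

theorem forward {n : ℕ} (hn : 3 ≤ n) {C : Set (DihedralGroup n)}
    (hgen : Subgroup.closure C = ⊤) (hcard : C.ncard = 4) (hT : TransSet C) :
    ∃ σ : MulAut (DihedralGroup n), Fam n (⇑σ '' C) := by
  obtain ⟨x, hinj, hC, hs⟩ := enum hn hgen hcard hT
  rcases comb (fun f => ∃ u v : ZMod n, ∀ b, u * x b + v = x (f b)) (by
    rintro f g ⟨u, v, h⟩ ⟨u', v', h'⟩
    refine ⟨u * u', u * v' + v, fun b => ?_⟩
    rw [← h, ← h']; ring) hs with ⟨f, ⟨u, v, huv⟩, hf⟩ | ⟨⟨l, v, hl⟩, ⟨m, v', hm⟩⟩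
  · simp only [fourc, Bool.and_eq_true, beq_iff_eq] at hf
    obtain ⟨hnd, h4⟩ := hf
    have hC' := hC.trans (range_four x _ _ _ _ hnd)
    simp only [nd, Bool.and_eq_true, bne_iff_ne] at hnd
    obtain ⟨⟨⟨⟨⟨a1, a2⟩, a3⟩, a4⟩, a5⟩, a6⟩ := hnd
    exact case_b hn hgen _ _ _ _ u v hC' (hinj.ne a1) (hinj.ne a2) (hinj.ne a4)
      (huv _) (huv _) (huv _) (by rw [huv, h4])
  · have hC' := hC.trans (range_four x 0 1 2 3 (by decide))
    have L0 : l * x 0 + v = x 1 := hl 0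
    have L1 : l * x 1 + v = x 0 := hl 1
    have L2 : l * x 2 + v = x 3 := hl 2
    have L3 : l * x 3 + v = x 2 := hl 3
    have M0 : m * x 0 + v' = x 2 := hm 0
    have M1 : m * x 1 + v' = x 3 := hm 1
    have M2 : m * x 2 + v' = x 0 := hm 2
    have M3 : m * x 3 + v' = x 1 := hm 3
    have hne : ∀ a b : Fin 4, a ≠ b → x a ≠ x b := fun a b h => hinj.ne h
    have hV : V4h n (x 1 - x 0) (x 2 - x 0) (x 3 - x 0) l m := by
      refine ⟨?_, ?_, ?_, ?_, ?_, ?_, ?_, sub_ne_zero.2 (hne 1 0 (by decide)),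
        sub_ne_zero.2 (hne 2 0 (by decide)), sub_ne_zero.2 (hne 3 0 (by decide)), ?_, ?_, ?_⟩
      · linear_combination L1 - L0
      · linear_combination L2 - L0
      · linear_combination L3 - L0
      · linear_combination M2 - M0
      · linear_combination M1 - M0
      · linear_combination M3 - M0
      · have : (1 : ZMod n) ∈ Ideal.span {x 1 - x 0, x 2 - x 0} := by
          apply gen_one hgen (x 0)
          rw [hC']
          rintro c (rfl | rfl | rfl | rfl)
          · exact ⟨_, rfl, by simp⟩
          · exact ⟨_, rfl, Ideal.subset_span (by simp)⟩
          · exact ⟨_, rfl, Ideal.subset_span (by simp)⟩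
          · refine ⟨_, rfl, Ideal.mem_span_pair.2 ⟨1, l, ?_⟩⟩
            linear_combination L2 - L0
        exact Ideal.mem_span_pair.1 this
      · exact fun h => hne 1 2 (by decide) (sub_left_injective h)
      · exact fun h => hne 1 3 (by decide) (sub_left_injective h)
      · exact fun h => hne 2 3 (by decide) (sub_left_injective h)
    obtain ⟨σ, hσ⟩ := case_V4 hn hV
    refine ⟨σ * dihAut n 1 (-x 0), ?_⟩
    have : ⇑(σ * dihAut n 1 (-x 0)) = ⇑σ ∘ ⇑(dihAut n 1 (-x 0)) := rfl
    rw [this, Set.image_comp, hC', dihAut_image n 1 (-x 0) (x 0) (x 1) (x 2) (x 3) 0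
      (x 1 - x 0) (x 2 - x 0) (x 3 - x 0) (by simp) (by simp; ring) (by simp; ring) (by simp; ring)]
    exact hσ

end Final

/-- Classification of `4`-valent normal edge-transitive Cayley graphs of
dihedral groups: an inverse-closed generating set `C` of `D_{2n}` with `|C| = 4` is
transitive iff, up to an automorphism of `G`, it belongs to one of the families (a), (b)
of Talebi or the new family (c). -/
theorem stmt19 (n : ℕ) (hn : 3 ≤ n) (C : Set (DihedralGroup n))
    (h1 : (1 : DihedralGroup n) ∉ C) (hinv : ∀ c ∈ C, c⁻¹ ∈ C)
    (hgen : Subgroup.closure C = ⊤) (hcard : C.ncard = 4) :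
    TransSet C ↔ ∃ σ : MulAut (DihedralGroup n),
      (∃ i : ℕ, 2 ≤ i ∧ i ≤ n - 1 ∧ Nat.gcd (2 * i - 1) n = 1 ∧ n ∣ 2 * i * (i - 1) ∧
        ⇑σ '' C = {DihedralGroup.sr 0, DihedralGroup.sr 1, DihedralGroup.sr (i : ZMod n),
          DihedralGroup.sr (1 - (i : ZMod n))}) ∨
      (∃ k : ℕ, 1 ≤ k ∧ k ≤ n - 2 ∧ Nat.Coprime k n ∧ n ∣ 1 + k + k ^ 2 + k ^ 3 ∧
        ⇑σ '' C = {DihedralGroup.sr 0, DihedralGroup.sr 1,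
          DihedralGroup.sr ((k + 1 : ℕ) : ZMod n),
          DihedralGroup.sr ((k ^ 2 + k + 1 : ℕ) : ZMod n)}) ∨
      (5 ≤ n ∧ ∃ i j k : ℕ, 1 < i ∧ i < n ∧ 1 < j ∧ j < n ∧ 1 < k ∧ k < n ∧
        Nat.Coprime i j ∧ Nat.Coprime i k ∧ Nat.Coprime j k ∧
        1 < Nat.gcd i n ∧ 1 < Nat.gcd j n ∧ 1 < Nat.gcd k n ∧
        (∃ l m : ℤ, (l : ZMod n) ^ 2 = 1 ∧ (m : ZMod n) ^ 2 = 1 ∧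
          (l : ZMod n) ≠ 1 ∧ (m : ZMod n) ≠ 1 ∧ (l : ZMod n) * (m : ZMod n) ≠ 1 ∧
          (k : ZMod n) = (j : ZMod n) * (l : ZMod n) + (i : ZMod n) ∧
          (k : ZMod n) = (i : ZMod n) * (m : ZMod n) + (j : ZMod n) ∧
          (i : ZMod n) * ((l : ZMod n) + 1) = 0 ∧
          (j : ZMod n) * ((m : ZMod n) + 1) = 0) ∧
        ⇑σ '' C = {DihedralGroup.sr 0, DihedralGroup.sr (i : ZMod n),
          DihedralGroup.sr (j : ZMod n), DihedralGroup.sr (k : ZMod n)}) := by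
  constructor
  · intro hT
    obtain ⟨σ, hσ⟩ := forward hn hgen hcard hT
    exact ⟨σ, hσ⟩
  · rintro ⟨σ, ⟨i, h2, _, hg, hd, hD⟩ | ⟨k, _, _, hg, hd, hD⟩ | ⟨_, i, j, k, _, _, _, _, _, _, _, _, _, _, _, _,
      ⟨l, m, hl, hm, _, _, _, e1, e2, e3, e4⟩, hD⟩⟩
    · exact trans_a σ i h2 hg hd hD
    · exact trans_b σ k hg hd hD
    · exact trans_c σ i j k l m hl hm e1 e2 e3 e4 hD

end NETCayley
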